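/- Let α > 2, λ > 0, β > 0, σ ≥ 0 with σ² ≤ 2λ, and x_* ∈ ℝ. Set c_α := 2α/(α−2) and d_α := (2(α+1)/(c_α(α−2)))^{1/3}. Suppose f is a classical solution on [0,T] of the superlinear consensus Fokker–Planck equation ∂_t f = λ ∂_x[(x − x_*)(1 + β f^α) f] + (σ²/2) ∂²_{xx}[(x − x_*)² f] with total mass ρ := ∫_ℝ f(x,0) dx > 0 and initial second moment V₀ := ∫_ℝ (x − x_*)² f(x,0) dx. Then necessarily T < t̄ := (c_α d_α + d_α^{−2})^{3α/2} V₀^{α/2} / (2λβ ρ^{3α/2}); in other words, no nonnegative classical solution with positive mass exists on a time interval reaching the explicit time t̄ (finite-time blow-up). -/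

import Mathlib

open MeasureTheory Set

/-- The constant `c_α = 2α/(α-2)`. -/
noncomputable def cConst (α : ℝ) : ℝ := 2 * α / (α - 2)

/-- The constant `d_α = (2(α+1)/(c_α (α-2)))^{1/3}`. -/
noncomputable def dConst (α : ℝ) : ℝ := (2 * (α + 1) / (cConst α * (α - 2))) ^ ((1 : ℝ) / 3)

/-- A classical solution on `[0,T]` of the one-dimensional superlinear consensus
Fokker–Planck equation
`∂_t f = λ ∂_x[(x - x_*)(1 + β f^α) f] + (σ²/2) ∂²_{xx}[(x - x_*)² f]`:
a nonnegative function `f(x,t)`, twice continuously differentiable in `x` and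
continuously differentiable in `t`, with `x`-support contained in a fixed compact set
for every `t ∈ [0,T]`, satisfying the equation pointwise. -/
def IsClassicalSolution (lam β σ α xstar T : ℝ) (f : ℝ → ℝ → ℝ) : Prop :=
  (∀ x t, t ∈ Icc (0 : ℝ) T → 0 ≤ f x t) ∧
  (∃ C : Set ℝ, IsCompact C ∧ ∀ t ∈ Icc (0 : ℝ) T, ∀ x : ℝ, f x t ≠ 0 → x ∈ C) ∧
  (∀ t ∈ Icc (0 : ℝ) T, ContDiff ℝ 2 (fun x => f x t)) ∧
  (∀ x : ℝ, ContDiffOn ℝ 1 (fun t => f x t) (Icc 0 T)) ∧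
  (∀ x : ℝ, ∀ t ∈ Icc (0 : ℝ) T,
    derivWithin (fun s => f x s) (Icc 0 T) t =
      lam * deriv (fun y => (y - xstar) * (1 + β * f y t ^ α) * f y t) x +
        σ ^ 2 / 2 * deriv (deriv (fun y => (y - xstar) ^ 2 * f y t)) x)

theorem HasDerivWithinAt.nonneg_of_forall_left_le {f : ℝ → ℝ} {f' c d t : ℝ}
    (hf : HasDerivWithinAt f f' (Icc c d) t) (hct : c < t) (htd : t ≤ d)
    (hmax : ∀ s, c ≤ s → s < t → f s ≤ f t) : 0 ≤ f' := by
  have h1 : HasDerivWithinAt f f' (Ioo c t) t :=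
    hf.mono fun s hs => ⟨hs.1.le, hs.2.le.trans htd⟩
  rw [hasDerivWithinAt_iff_tendsto_slope' (by simp)] at h1
  have := right_nhdsWithin_Ioo_neBot hct
  refine ge_of_tendsto h1 ?_
  filter_upwards [self_mem_nhdsWithin] with s hs
  rw [slope_def_field]
  exact div_nonneg_of_nonpos (sub_nonpos.2 (hmax s hs.1.le hs.2)) (sub_nonpos.2 hs.2.le)

theorem HasDerivWithinAt.nonpos_of_forall_right_le {f : ℝ → ℝ} {f' c d t : ℝ}
    (hf : HasDerivWithinAt f f' (Icc c d) t) (hct : c ≤ t) (htd : t < d)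
    (hmax : ∀ s, t < s → s ≤ d → f s ≤ f t) : f' ≤ 0 := by
  have h1 : HasDerivWithinAt f f' (Ioo t d) t :=
    hf.mono fun s hs => ⟨hct.trans hs.1.le, hs.2.le⟩
  rw [hasDerivWithinAt_iff_tendsto_slope' (by simp)] at h1
  have := left_nhdsWithin_Ioo_neBot htd
  refine le_of_tendsto h1 ?_
  filter_upwards [self_mem_nhdsWithin] with s hs
  rw [slope_def_field]
  exact div_nonpos_of_nonpos_of_nonneg (sub_nonpos.2 (hmax s hs.1 hs.2.le))
    (sub_nonneg.2 hs.1.le)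

/-- `g` is an increasing convex flux on `[0, ∞)` with derivative `g'`. -/
structure IsFlux (g g' : ℝ → ℝ) : Prop where
  hasDerivAt : ∀ v, 0 ≤ v → HasDerivAt g (g' v) v
  one_le : ∀ v, 0 ≤ v → 1 ≤ g' v
  monotoneOn : MonotoneOn g' (Ici 0)
  lipschitz : ∀ U, ∃ K, 0 ≤ K ∧ ∀ v ∈ Icc 0 U, ∀ w ∈ Icc 0 U, |g' v - g' w| ≤ K * |v - w|
  self_le : ∀ v, 0 ≤ v → v ≤ g v

namespace IsFlux

variable {g g' : ℝ → ℝ}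

theorem continuousOn (hg : IsFlux g g') : ContinuousOn g (Ici 0) :=
  fun v hv => (hg.hasDerivAt v hv).continuousAt.continuousWithinAt

theorem sub_le (hg : IsFlux g g') {v w : ℝ} (hv : 0 ≤ v) (hvw : v ≤ w) :
    g w - g v ≤ g' w * (w - v) := by
  refine (convex_Icc v w).image_sub_le_mul_sub_of_deriv_le
    (fun z hz => (hg.hasDerivAt z (hv.trans hz.1)).continuousAt.continuousWithinAt)
    (fun z hz => ?_) (fun z hz => ?_) v ⟨le_rfl, hvw⟩ w ⟨hvw, le_rfl⟩ hvw
  all_goals rw [interior_Icc] at hz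
  · exact (hg.hasDerivAt z (hv.trans hz.1.le)).differentiableAt.differentiableWithinAt
  · rw [(hg.hasDerivAt z (hv.trans hz.1.le)).deriv]
    exact hg.monotoneOn (hv.trans hz.1.le) (hv.trans hvw) hz.2.le

theorem sub_le_sub (hg : IsFlux g g') {v w : ℝ} (hv : 0 ≤ v) (hvw : v ≤ w) :
    w - v ≤ g w - g v := by
  have := (convex_Icc v w).mul_sub_le_image_sub_of_le_deriv (C := 1)
    (fun z hz => (hg.hasDerivAt z (hv.trans hz.1)).continuousAt.continuousWithinAt)
    (fun z hz => ?_) (fun z hz => ?_) v ⟨le_rfl, hvw⟩ w ⟨hvw, le_rfl⟩ hvw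
  · simpa using this
  all_goals rw [interior_Icc] at hz
  · exact (hg.hasDerivAt z (hv.trans hz.1.le)).differentiableAt.differentiableWithinAt
  · rw [(hg.hasDerivAt z (hv.trans hz.1.le)).deriv]
    exact hg.one_le _ (hv.trans hz.1.le)

theorem mono (hg : IsFlux g g') {v w : ℝ} (hv : 0 ≤ v) (hvw : v ≤ w) : g v ≤ g w := by
  have := hg.sub_le_sub hv hvw
  linarith

theorem nonneg (hg : IsFlux g g') {v : ℝ} (hv : 0 ≤ v) : 0 ≤ g v :=
  hv.trans (hg.self_le v hv)

end IsFlux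

/-- `u` is a nonnegative solution on `[a,b] × [c,d]` of `∂ₜ u = κ ∂ₓ (x g(u))`, separately
differentiable, with lateral slopes bounded by `Λ` and lateral values bounded by `E`. -/
structure TransportSolution (g g' : ℝ → ℝ) (κ a b c d : ℝ) (u ux : ℝ → ℝ → ℝ) (Λ E : ℝ) :
    Prop where
  nonneg : ∀ x ∈ Icc a b, ∀ t ∈ Icc c d, 0 ≤ u x t
  deriv_x : ∀ x ∈ Icc a b, ∀ t ∈ Icc c d, HasDerivAt (fun y => u y t) (ux x t) x
  deriv_t : ∀ x ∈ Icc a b, ∀ t ∈ Icc c d,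
    HasDerivWithinAt (u x) (κ * (g (u x t) + x * g' (u x t) * ux x t)) (Icc c d) t
  slope_left : ∀ t ∈ Icc c d, |ux a t| ≤ Λ
  slope_right : ∀ t ∈ Icc c d, |ux b t| ≤ Λ
  edge_left : ∀ t ∈ Icc c d, u a t ≤ E
  edge_right : ∀ t ∈ Icc c d, u b t ≤ E

namespace TransportSolution

variable {g g' : ℝ → ℝ} {κ a b c d Λ E : ℝ} {u ux : ℝ → ℝ → ℝ}

theorem restrict (h : TransportSolution g g' κ a b c d u ux Λ E) {c' d' : ℝ} (hc : c ≤ c')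
    (hd : d' ≤ d) : TransportSolution g g' κ a b c' d' u ux Λ E :=
  have hs : Icc c' d' ⊆ Icc c d := Icc_subset_Icc hc hd
  ⟨fun x hx t ht => h.nonneg x hx t (hs ht), fun x hx t ht => h.deriv_x x hx t (hs ht),
    fun x hx t ht => (h.deriv_t x hx t (hs ht)).mono hs, fun t ht => h.slope_left t (hs ht),
    fun t ht => h.slope_right t (hs ht), fun t ht => h.edge_left t (hs ht),
    fun t ht => h.edge_right t (hs ht)⟩

theorem reflect (h : TransportSolution g g' κ a b c d u ux Λ E) :
    TransportSolution g g' κ (-b) (-a) c d (fun x t => u (-x) t) (fun x t => -ux (-x) t)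
      Λ E := by
  have hm : ∀ x ∈ Icc (-b) (-a), -x ∈ Icc a b := fun x hx =>
    ⟨by linarith [hx.2], by linarith [hx.1]⟩
  refine ⟨fun x hx => h.nonneg _ (hm x hx), fun x hx t ht => ?_, fun x hx t ht => ?_, ?_, ?_,
    ?_, ?_⟩
  · simpa [Function.comp_def] using (h.deriv_x _ (hm x hx) t ht).scomp x (hasDerivAt_neg x)
  · convert h.deriv_t _ (hm x hx) t ht using 2
    ring
  · simpa using h.slope_right
  · simpa using h.slope_left
  · simpa using h.edge_right
  · simpa using h.edge_left

theorem timeReverse (h : TransportSolution g g' κ a b c d u ux Λ E) :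
    TransportSolution g g' (-κ) a b (-d) (-c) (fun x t => u x (-t)) (fun x t => ux x (-t))
      Λ E := by
  have hm : ∀ t ∈ Icc (-d) (-c), -t ∈ Icc c d := fun x hx =>
    ⟨by linarith [hx.2], by linarith [hx.1]⟩
  refine ⟨fun x hx t ht => h.nonneg x hx _ (hm t ht), fun x hx t ht => h.deriv_x x hx _ (hm t ht),
    fun x hx t ht => ?_, fun t ht => h.slope_left _ (hm t ht), fun t ht =>
      h.slope_right _ (hm t ht), fun t ht => h.edge_left _ (hm t ht), fun t ht =>
      h.edge_right _ (hm t ht)⟩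
  have := (h.deriv_t x hx _ (hm t ht)).scomp t (hasDerivAt_neg t).hasDerivWithinAt
    (s := Icc (-d) (-c)) hm
  simpa [Function.comp_def] using this

theorem continuousOn_t (h : TransportSolution g g' κ a b c d u ux Λ E) {x : ℝ}
    (hx : x ∈ Icc a b) : ContinuousOn (u x) (Icc c d) :=
  fun t ht => (h.deriv_t x hx t ht).continuousWithinAt

theorem max_principle (hg : IsFlux g g') (h : TransportSolution g g' κ a b c d u ux Λ E)
    (hu : ContinuousOn (fun p : ℝ × ℝ => u p.1 p.2) (Icc a b ×ˢ Icc c d)) {s K : ℝ}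
    (h0 : ∀ x ∈ Icc a b, s * x * g (u x c) ≤ K)
    (ha : 0 < κ * a ∨ ∀ t ∈ Icc c d, s * a * g (u a t) ≤ K)
    (hb : ∀ t ∈ Icc c d, s * b * g (u b t) ≤ K) :
    ∀ x ∈ Icc a b, ∀ t ∈ Icc c d, s * x * g (u x t) ≤ K := by
  intro x0 hx0 t0 ht0
  by_contra! hlt
  obtain ⟨δ, hδ, hδ'⟩ : ∃ δ > 0, K < s * x0 * g (u x0 t0) - δ * (t0 - c) := by
    refine ⟨(s * x0 * g (u x0 t0) - K) / (2 * (t0 - c + 1)),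
      div_pos (by linarith) (by linarith [ht0.1]), ?_⟩
    have h1 : 0 ≤ t0 - c := by linarith [ht0.1]
    have : (s * x0 * g (u x0 t0) - K) / (2 * (t0 - c + 1)) * (t0 - c)
        ≤ (s * x0 * g (u x0 t0) - K) / 2 := by
      rw [div_mul_eq_mul_div, div_le_div_iff₀ (by linarith) (by norm_num)]
      nlinarith
    linarith
  have hcont : ContinuousOn (fun p : ℝ × ℝ => s * p.1 * g (u p.1 p.2) - δ * (p.2 - c))
      (Icc a b ×ˢ Icc c d) := by
    refine ContinuousOn.sub (ContinuousOn.mul (by fun_prop) ?_) (by fun_prop)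
    exact hg.continuousOn.comp hu fun p hp => h.nonneg _ hp.1 _ hp.2
  obtain ⟨⟨x1, t1⟩, ⟨hx1, ht1⟩, hmax⟩ := (isCompact_Icc.prod isCompact_Icc).exists_isMaxOn
    ⟨(x0, t0), hx0, ht0⟩ hcont
  have hmax' : ∀ x ∈ Icc a b, ∀ t ∈ Icc c d, s * x * g (u x t) - δ * (t - c) ≤
      s * x1 * g (u x1 t1) - δ * (t1 - c) := fun x hx t ht => hmax (a := (x, t)) ⟨hx, ht⟩
  simp only at hx1 ht1
  have hK := hδ'.trans_le (hmax' x0 hx0 t0 ht0)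
  have hct : c < t1 := by
    refine lt_of_le_of_ne ht1.1 fun hc => ?_
    subst hc
    have := h0 x1 hx1
    linarith
  have hδt : 0 < δ * (t1 - c) := mul_pos hδ (by linarith)
  have hxb : x1 < b := by
    refine lt_of_le_of_ne hx1.2 fun hc => ?_
    subst hc
    have := hb t1 ht1
    linarith
  have hu0 := h.nonneg x1 hx1 t1 ht1
  have hg1 := hg.one_le _ hu0
  have hdt : HasDerivWithinAt (fun t => s * x1 * g (u x1 t) - δ * (t - c))
      (s * x1 * (g' (u x1 t1) * (κ * (g (u x1 t1) + x1 * g' (u x1 t1) * ux x1 t1))) - δ * 1)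
      (Icc c d) t1 :=
    (((hg.hasDerivAt _ hu0).comp_hasDerivWithinAt t1 (h.deriv_t x1 hx1 t1 ht1)).const_mul _).sub
      (((hasDerivWithinAt_id t1 _).sub_const c).const_mul δ)
  have h1 := hdt.nonneg_of_forall_left_le hct ht1.2 fun r hr hrt =>
    hmax' x1 hx1 r ⟨hr, hrt.le.trans ht1.2⟩
  have hdx : HasDerivAt (fun x => s * (x * g (u x t1)) - δ * (t1 - c))
      (s * (1 * g (u x1 t1) + x1 * (g' (u x1 t1) * ux x1 t1))) x1 :=
    (((hasDerivAt_id x1).mul ((hg.hasDerivAt _ hu0).comp x1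
      (h.deriv_x x1 hx1 t1 ht1))).const_mul s).sub_const _
  have h2 : s * (1 * g (u x1 t1) + x1 * (g' (u x1 t1) * ux x1 t1)) ≤ 0 :=
    (hdx.hasDerivWithinAt (s := Icc a b)).nonpos_of_forall_right_le hx1.1 hxb
      fun y hy hyb => by
        have := hmax' y ⟨hx1.1.trans hy.le, hyb⟩ t1 ht1
        simpa only [mul_assoc] using this
  rcases hx1.1.eq_or_lt with hax | hax
  · rcases ha with ha | ha
    · rw [hax] at ha
      have : κ * x1 * g' (u x1 t1) * (s * (1 * g (u x1 t1) + x1 * (g' (u x1 t1) * ux x1 t1)))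
          ≤ 0 := mul_nonpos_of_nonneg_of_nonpos (by positivity) h2
      nlinarith
    · have := ha t1 ht1
      rw [hax] at this
      linarith
  · have h3 : 0 ≤ s * (1 * g (u x1 t1) + x1 * (g' (u x1 t1) * ux x1 t1)) :=
      (hdx.hasDerivWithinAt (s := Icc a b)).nonneg_of_forall_left_le hax hx1.2
        fun y hy hyb => by
          have := hmax' y ⟨hy, hyb.le.trans hx1.2⟩ t1 ht1
          simpa only [mul_assoc] using this
    have h4 := le_antisymm h2 h3
    have : s * x1 * (g' (u x1 t1) * (κ * (g (u x1 t1) + x1 * g' (u x1 t1) * ux x1 t1))) = 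
      κ * x1 * g' (u x1 t1) * (s * (1 * g (u x1 t1) + x1 * (g' (u x1 t1) * ux x1 t1))) := by ring
    rw [this, h4] at h1
    linarith

theorem two_point_slope (h : TransportSolution g g' κ a b c d u ux Λ E)
    (hu : ContinuousOn (fun p : ℝ × ℝ => u p.1 p.2) (Icc a b ×ˢ Icc c d)) {φ φ' : ℝ → ℝ} {e : ℝ}
    (hφ : ∀ t ∈ Icc c d, HasDerivAt φ (φ' t) t) (hΛ : ∀ t ∈ Icc c d, Λ < φ t) (he : 0 < e)
    (h0 : ∀ x ∈ Icc a b, ∀ y ∈ Icc a b, y ≤ x → u x c - u y c < φ c * (x - y + e))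
    (step : ∀ t ∈ Icc c d, ∀ x ∈ Icc a b, ∀ y ∈ Icc a b, y < x →
      u x t - u y t = φ t * (x - y + e) →
      κ * (g (u x t) + x * g' (u x t) * φ t) - κ * (g (u y t) + y * g' (u y t) * φ t) <
        φ' t * (x - y + e)) :
    ∀ t ∈ Icc c d, ∀ x ∈ Icc a b, ∀ y ∈ Icc a b, y ≤ x → u x t - u y t < φ t * (x - y + e) := by
  intro t0 ht0 x0 hx0 y0 hy0 hyx0
  by_contra! hle
  set Z : ℝ × ℝ × ℝ → ℝ := fun p =>
    u p.2.1 p.1 - u p.2.2 p.1 - φ p.1 * (p.2.1 - p.2.2 + e) with hZ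
  have hφc : ContinuousOn φ (Icc c d) := fun t ht => (hφ t ht).continuousAt.continuousWithinAt
  have hcont : ContinuousOn Z (Icc c d ×ˢ Icc a b ×ˢ Icc a b) := by
    refine ((hu.comp (f := fun p : ℝ × ℝ × ℝ => (p.2.1, p.1)) (by fun_prop)
      fun p hp => ⟨hp.2.1, hp.1⟩).sub (hu.comp (f := fun p : ℝ × ℝ × ℝ => (p.2.2, p.1))
      (by fun_prop) fun p hp => ⟨hp.2.2, hp.1⟩)).sub (ContinuousOn.mul
        (hφc.comp (by fun_prop) fun p hp => hp.1) (by fun_prop))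
  have hcomp : IsCompact (Icc c d ×ˢ Icc a b ×ˢ Icc a b : Set (ℝ × ℝ × ℝ)) :=
    isCompact_Icc.prod (isCompact_Icc.prod isCompact_Icc)
  have hS1 : IsCompact ((Icc c d ×ˢ Icc a b ×ˢ Icc a b) ∩ Z ⁻¹' (Ici 0)) :=
    hcomp.of_isClosed_subset (hcont.preimage_isClosed_of_isClosed hcomp.isClosed isClosed_Ici)
      inter_subset_left
  have hS : IsCompact (((Icc c d ×ˢ Icc a b ×ˢ Icc a b) ∩ Z ⁻¹' (Ici 0)) ∩
      {p : ℝ × ℝ × ℝ | p.2.2 ≤ p.2.1}) :=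
    hS1.inter_right (isClosed_le (by fun_prop) (by fun_prop))
  obtain ⟨⟨t1, x1, y1⟩, ⟨⟨⟨ht1, hx1, hy1⟩, hZ1⟩, hyx1⟩, hmin⟩ :=
    hS.exists_isMinOn (f := fun p : ℝ × ℝ × ℝ => p.1)
      ⟨(t0, x0, y0), ⟨⟨ht0, hx0, hy0⟩, by simpa [hZ] using hle⟩, hyx0⟩ (by fun_prop)
  simp only at ht1 hx1 hy1 hyx1
  simp only [mem_preimage, mem_Ici, mem_ofPred_eq] at hZ1 hyx1
  have hlt : ∀ t, c ≤ t → t < t1 → ∀ x ∈ Icc a b, ∀ y ∈ Icc a b, y ≤ x → Z (t, x, y) < 0 := by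
    intro t hct htt x hx y hy hyx
    by_contra! hc
    have : t1 ≤ t := hmin (a := (t, x, y)) ⟨⟨⟨⟨hct, htt.le.trans ht1.2⟩, hx, hy⟩, hc⟩, hyx⟩
    linarith
  have hct : c < t1 := by
    refine lt_of_le_of_ne ht1.1 fun hc => ?_
    have := h0 x1 hx1 y1 hy1 hyx1
    rw [hc] at this
    simp only [hZ] at hZ1
    linarith
  have hle1 : ∀ x ∈ Icc a b, ∀ y ∈ Icc a b, y ≤ x → Z (t1, x, y) ≤ 0 := by
    intro x hx y hy hyx
    have h1 : ContinuousWithinAt (fun t => Z (t, x, y)) (Ioo c t1) t1 := by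
      have : ContinuousOn (fun t => Z (t, x, y)) (Icc c d) :=
        hcont.comp (by fun_prop) fun t ht => ⟨ht, hx, hy⟩
      exact (this t1 ht1).mono fun s hs => ⟨hs.1.le, hs.2.le.trans ht1.2⟩
    have := right_nhdsWithin_Ioo_neBot hct
    refine le_of_tendsto h1 ?_
    filter_upwards [self_mem_nhdsWithin] with s hs
    exact (hlt s hs.1.le hs.2 x hx y hy hyx).le
  have hZ0 : Z (t1, x1, y1) = 0 := le_antisymm (hle1 x1 hx1 y1 hy1 hyx1) hZ1
  have hφ0 : 0 < φ t1 := (abs_nonneg _).trans_lt ((h.slope_left t1 ht1).trans_lt (hΛ t1 ht1))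
  have hyx : y1 < x1 := by
    refine lt_of_le_of_ne hyx1 fun hc => ?_
    rw [hc] at hZ0
    simp only [hZ] at hZ0
    nlinarith
  have hdx : HasDerivAt (fun x => Z (t1, x, y1)) (ux x1 t1 - φ t1 * 1) x1 :=
    ((h.deriv_x x1 hx1 t1 ht1).sub_const (u y1 t1)).sub
      ((((hasDerivAt_id x1).sub_const y1).add_const e).const_mul (φ t1))
  have hdy : HasDerivAt (fun y => Z (t1, x1, y)) (-ux y1 t1 - φ t1 * (-1)) y1 :=
    ((h.deriv_x y1 hy1 t1 ht1).const_sub (u x1 t1)).sub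
      ((((hasDerivAt_id y1).const_sub x1).add_const e).const_mul (φ t1))
  have hx2 : 0 ≤ ux x1 t1 - φ t1 * 1 :=
    (hdx.hasDerivWithinAt (s := Icc y1 x1)).nonneg_of_forall_left_le hyx le_rfl
      fun s hs hsx => by
        rw [hZ0]; exact hle1 s ⟨hy1.1.trans hs, hsx.le.trans hx1.2⟩ y1 hy1 hs
  have hy2 : -ux y1 t1 - φ t1 * (-1) ≤ 0 :=
    (hdy.hasDerivWithinAt (s := Icc y1 x1)).nonpos_of_forall_right_le le_rfl hyx
      fun s hs hsx => by
        rw [hZ0]; exact hle1 x1 hx1 s ⟨hy1.1.trans hs.le, hsx.trans hx1.2⟩ hsx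
  have hxb : x1 < b := by
    refine lt_of_le_of_ne hx1.2 fun hc => ?_
    have := (le_abs_self _).trans (h.slope_right t1 ht1)
    rw [← hc] at this
    linarith [hΛ t1 ht1]
  have hya : a < y1 := by
    refine lt_of_le_of_ne hy1.1 fun hc => ?_
    have := (le_abs_self _).trans (h.slope_left t1 ht1)
    rw [hc] at this
    linarith [hΛ t1 ht1]
  have hx3 : ux x1 t1 - φ t1 * 1 ≤ 0 :=
    (hdx.hasDerivWithinAt (s := Icc x1 b)).nonpos_of_forall_right_le le_rfl hxb
      fun s hs hsx => by
        rw [hZ0]; exact hle1 s ⟨hx1.1.trans hs.le, hsx⟩ y1 hy1 (hyx1.trans hs.le)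
  have hy3 : 0 ≤ -ux y1 t1 - φ t1 * (-1) :=
    (hdy.hasDerivWithinAt (s := Icc a y1)).nonneg_of_forall_left_le hya le_rfl
      fun s hs hsx => by
        rw [hZ0]; exact hle1 x1 hx1 s ⟨hs, hsx.le.trans hy1.2⟩ (hsx.le.trans hyx1)
  have hux : ux x1 t1 = φ t1 := by linarith
  have huy : ux y1 t1 = φ t1 := by linarith
  have hdt : HasDerivWithinAt (fun t => Z (t, x1, y1))
      (κ * (g (u x1 t1) + x1 * g' (u x1 t1) * ux x1 t1) -
        κ * (g (u y1 t1) + y1 * g' (u y1 t1) * ux y1 t1) - φ' t1 * (x1 - y1 + e))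
      (Icc c d) t1 :=
    ((h.deriv_t x1 hx1 t1 ht1).sub (h.deriv_t y1 hy1 t1 ht1)).sub
      ((hφ t1 ht1).hasDerivWithinAt.mul_const (x1 - y1 + e))
  have h5 := hdt.nonneg_of_forall_left_le hct ht1.2 fun s hs hst => by
    rw [hZ0]; exact (hlt s hs hst x1 hx1 y1 hy1 hyx1).le
  rw [hux, huy] at h5
  simp only [hZ] at hZ0
  have h6 := step t1 ht1 x1 hx1 y1 hy1 hyx (by linarith)
  linarith

end TransportSolution

open Filter Topology

/-- `v` is Lipschitz on `[a,b]` with constant `L`. -/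
def SlopeBound (v : ℝ → ℝ) (a b L : ℝ) : Prop :=
  ∀ x ∈ Icc a b, ∀ y ∈ Icc a b, |v x - v y| ≤ L * |x - y|

theorem slopeBound_of_le {v : ℝ → ℝ} {a b L : ℝ}
    (h1 : ∀ x ∈ Icc a b, ∀ y ∈ Icc a b, y ≤ x → v x - v y ≤ L * (x - y))
    (h2 : ∀ x ∈ Icc a b, ∀ y ∈ Icc a b, y ≤ x → v y - v x ≤ L * (x - y)) :
    SlopeBound v a b L := by
  intro x hx y hy
  rcases le_total y x with hyx | hxy
  · rw [abs_of_nonneg (sub_nonneg.2 hyx), abs_le]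
    constructor <;> linarith [h1 x hx y hy hyx, h2 x hx y hy hyx]
  · rw [abs_of_nonpos (sub_nonpos.2 hxy), abs_le]
    constructor <;> linarith [h1 y hy x hx hxy, h2 y hy x hx hxy]

namespace SlopeBound

variable {v : ℝ → ℝ} {a b L M : ℝ}

theorem mono (h : SlopeBound v a b L) (hLM : L ≤ M) : SlopeBound v a b M :=
  fun x hx y hy => (h x hx y hy).trans (mul_le_mul_of_nonneg_right hLM (abs_nonneg _))

theorem reflect (h : SlopeBound v a b L) : SlopeBound (fun x => v (-x)) (-b) (-a) L := by
  intro x hx y hy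
  have := h (-x) ⟨by linarith [hx.2], by linarith [hx.1]⟩ (-y)
    ⟨by linarith [hy.2], by linarith [hy.1]⟩
  rwa [show -x - -y = -(x - y) by ring, abs_neg] at this

theorem sub_le (h : SlopeBound v a b L) {x y : ℝ} (hx : x ∈ Icc a b) (hy : y ∈ Icc a b)
    (hyx : y ≤ x) : v x - v y ≤ L * (x - y) := by
  have := (le_abs_self _).trans (h x hx y hy)
  rwa [abs_of_nonneg (sub_nonneg.2 hyx)] at this

theorem le_add (h : SlopeBound v a b L) (hL : 0 ≤ L) {x : ℝ} (hx : x ∈ Icc a b) :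
    v x ≤ v a + L * (b - a) := by
  have h1 := h.sub_le hx ⟨le_rfl, hx.1.trans hx.2⟩ hx.1
  have : L * (x - a) ≤ L * (b - a) := mul_le_mul_of_nonneg_left (by linarith [hx.2]) hL
  linarith

theorem continuousOn_prod {u : ℝ → ℝ → ℝ} {c d : ℝ}
    (ht : ∀ x ∈ Icc a b, ContinuousOn (u x) (Icc c d))
    (hL : ∀ t ∈ Icc c d, SlopeBound (fun x => u x t) a b L) :
    ContinuousOn (fun p : ℝ × ℝ => u p.1 p.2) (Icc a b ×ˢ Icc c d) := by
  refine continuousOn_prod_of_continuousOn_lipschitzOnWith _ L.toNNReal ht fun t htt => ?_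
  refine LipschitzOnWith.of_dist_le_mul fun x hx y hy => ?_
  simp only [Real.dist_eq]
  exact (hL t htt x hx y hy).trans
    (mul_le_mul_of_nonneg_right (Real.le_coe_toNNReal L) (abs_nonneg _))

end SlopeBound

theorem eventually_forall_abs_sub_le {v : ℝ → ℝ → ℝ} {a b c n Φ η : ℝ} {l : Filter ℝ}
    (hc : ∀ x ∈ Icc a b, Tendsto (v x) l (𝓝 (v x c)))
    (hΦ : ∀ᶠ t in l, ∀ x ∈ Icc a b, ∀ y ∈ Icc a b, y ≤ x → v x t - v y t ≤ Φ * (x - y))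
    (hn : SlopeBound (fun x => v x c) a b n) (hη : 0 < η) :
    ∀ᶠ t in l, ∀ x ∈ Icc a b, |v x t - v x c| ≤ η := by
  set M := |Φ| + |n| + 1 with hM
  have hM0 : 0 < M := by positivity
  set h := η / (2 * M) with hh
  have hh0 : 0 < h := by positivity
  set X : ℕ → ℝ := fun i => min b (a + i * h) with hX
  have hev : ∀ᶠ t in l, ∀ i ∈ Finset.range (⌈(b - a) / h⌉₊ + 2), a ≤ b →
      |v (X i) t - v (X i) c| < η / 2 := by
    rw [Filter.eventually_all_finset]
    intro i _
    by_cases hab : a ≤ b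
    · have hXi : X i ∈ Icc a b := ⟨le_min hab (by nlinarith [(Nat.cast_nonneg i : (0 : ℝ) ≤ i)]),
        min_le_left _ _⟩
      filter_upwards [(hc (X i) hXi).eventually (Metric.ball_mem_nhds _ (half_pos hη))]
        with t ht _ using by simpa [Real.dist_eq] using ht
    · exact Eventually.of_forall fun t h => absurd h hab
  filter_upwards [hev, hΦ] with t ht hΦt x hx
  have hab := hx.1.trans hx.2
  have hXm : ∀ i, X i ∈ Icc a b := fun i =>
    ⟨le_min hab (by nlinarith [(Nat.cast_nonneg i : (0 : ℝ) ≤ i)]), min_le_left _ _⟩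
  set i := ⌊(x - a) / h⌋₊ with hi
  have hi1 : (i : ℝ) * h ≤ x - a := by
    have := Nat.floor_le (div_nonneg (sub_nonneg.2 hx.1) hh0.le)
    rwa [le_div_iff₀ hh0] at this
  have hi2 : x - a < (i + 1) * h := by
    have := Nat.lt_floor_add_one ((x - a) / h)
    rwa [div_lt_iff₀ hh0] at this
  have hiN : i ≤ ⌈(b - a) / h⌉₊ := by
    refine (Nat.floor_le_floor (div_le_div_of_nonneg_right (by linarith [hx.2]) hh0.le)).trans
      (Nat.floor_le_ceil _)
  have hXi : X i = a + i * h := min_eq_right (by linarith [hx.2])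
  have hlo : X i ≤ x := by rw [hXi]; linarith
  have hup : x ≤ X (i + 1) := le_min hx.2 (by push_cast; linarith)
  have hup' : X (i + 1) ≤ X i + h := by
    rw [hXi]
    exact (min_le_right _ _).trans (by push_cast; linarith)
  have e1 := abs_lt.1 (ht i (Finset.mem_range.2 (by lia)) hab)
  have e2 := abs_lt.1 (ht (i + 1) (Finset.mem_range.2 (by lia)) hab)
  have f1 := hΦt x hx _ (hXm i) hlo
  have f2 := hΦt _ (hXm (i + 1)) x hx hup
  have n1 := abs_le.1 (hn x hx _ (hXm i))
  have n2 := abs_le.1 (hn x hx _ (hXm (i + 1)))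
  have key : ∀ r, 0 ≤ r → r ≤ h → Φ * r + n * r ≤ η / 2 := by
    intro r hr hrh
    have h1 : Φ * r + n * r ≤ M * r := by
      rw [← add_mul]
      exact mul_le_mul_of_nonneg_right
        (by rw [hM]; linarith [le_abs_self Φ, le_abs_self n]) hr
    have h2 : M * r ≤ M * h := mul_le_mul_of_nonneg_left hrh hM0.le
    have h3 : M * h = η / 2 := by rw [hh]; field_simp
    linarith
  have k1 := key (x - X i) (by linarith) (by linarith)
  have k2 := key (X (i + 1) - x) (by linarith) (by linarith)
  rw [abs_of_nonneg (by linarith : 0 ≤ x - X i)] at n1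
  rw [abs_of_nonpos (by linarith : x - X (i + 1) ≤ 0)] at n2
  simp only at n1 n2
  rw [abs_le]
  constructor <;> linarith

namespace TransportSolution

variable {g g' : ℝ → ℝ} {κ a b c d Λ E : ℝ} {u ux : ℝ → ℝ → ℝ}

theorem le_of_initial_le (hg : IsFlux g g') (h : TransportSolution g g' κ a b c d u ux Λ E)
    (hu : ContinuousOn (fun p : ℝ × ℝ => u p.1 p.2) (Icc a b ×ˢ Icc c d)) {s m X U : ℝ}
    (hm : 0 < m) (hs : ∀ x ∈ Icc a b, m ≤ s * x ∧ s * x ≤ X) (hab : a ≤ b) (hE : E ≤ U)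
    (h0 : ∀ x ∈ Icc a b, u x c ≤ U) :
    ∀ x ∈ Icc a b, ∀ t ∈ Icc c d, u x t ≤ X * g U / m := by
  intro x hx t ht
  have hct : c ≤ d := ht.1.trans ht.2
  have hX : 0 ≤ X := by linarith [hs x hx]
  have key : ∀ y ∈ Icc a b, ∀ r ∈ Icc c d, u y r ≤ U → s * y * g (u y r) ≤ X * g U := by
    intro y hy r hr hur
    have h1 := h.nonneg y hy r hr
    exact mul_le_mul (hs y hy).2 (hg.mono h1 hur) (hg.nonneg h1) hX
  have := h.max_principle hg hu (s := s) (K := X * g U)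
    (fun y hy => key y hy c ⟨le_rfl, hct⟩ (h0 y hy))
    (Or.inr fun r hr => key a ⟨le_rfl, hab⟩ r hr ((h.edge_left r hr).trans hE))
    (fun r hr => key b ⟨hab, le_rfl⟩ r hr ((h.edge_right r hr).trans hE)) x hx t ht
  have h1 := h.nonneg x hx t ht
  rw [le_div_iff₀ hm]
  have h2 : m * u x t ≤ s * x * g (u x t) :=
    mul_le_mul (hs x hx).1 (hg.self_le _ h1) h1 (hm.le.trans (hs x hx).1)
  linarith

theorem upper_slope_of_nonpos (hg : IsFlux g g')
    (h : TransportSolution g g' κ a b c d u ux Λ E)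
    (hu : ContinuousOn (fun p : ℝ × ℝ => u p.1 p.2) (Icc a b ×ˢ Icc c d)) {U n φ₀ : ℝ}
    (hκ : ∀ x ∈ Icc a b, κ * x ≤ 0) (hU0 : 0 ≤ U)
    (hU : ∀ x ∈ Icc a b, ∀ t ∈ Icc c d, u x t ≤ U)
    (h0 : SlopeBound (fun x => u x c) a b n) (hn : n < φ₀) (hΛ : Λ < φ₀) :
    ∀ t ∈ Icc c d, ∀ x ∈ Icc a b, ∀ y ∈ Icc a b, y ≤ x →
      u x t - u y t ≤ φ₀ * Real.exp ((2 * |κ| * g' U + 1) * (d - c)) * (x - y) := by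
  intro t ht x hx y hy hyx
  set C := 2 * |κ| * g' U + 1 with hC
  have hG : 0 ≤ g' U := by linarith [hg.one_le U hU0]
  have hC0 : 0 < C := by positivity
  have hφ0 : 0 < φ₀ := (abs_nonneg _).trans_lt ((h.slope_left t ht).trans_lt hΛ)
  have main : ∀ e > 0, u x t - u y t < φ₀ * Real.exp (C * (t - c)) * (x - y + e) := by
    intro e he
    refine h.two_point_slope hu (φ := fun t => φ₀ * Real.exp (C * (t - c)))
      (φ' := fun t => C * (φ₀ * Real.exp (C * (t - c)))) (fun r hr => ?_) (fun r hr => ?_) he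
      (fun x hx y hy hyx => ?_) (fun r hr x hx y hy hyx heq => ?_) t ht x hx y hy hyx
    · have := ((((hasDerivAt_id r).sub_const c).const_mul C).exp).const_mul φ₀
      exact this.congr_deriv (by simp only [id_eq]; ring)
    · refine hΛ.trans_le (le_mul_of_one_le_right hφ0.le (Real.one_le_exp ?_))
      exact mul_nonneg hC0.le (by linarith [hr.1])
    · have := h0.sub_le hx hy hyx
      simp only [sub_self, mul_zero, Real.exp_zero, mul_one]
      have : n * (x - y) ≤ φ₀ * (x - y) := mul_le_mul_of_nonneg_right hn.le (by linarith)
      nlinarith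
    · set φ := φ₀ * Real.exp (C * (r - c)) with hφ
      have hφ1 : 0 < φ := by positivity
      set p := u x r
      set q := u y r
      set D := x - y + e with hD
      have hD0 : 0 < D := by linarith
      have hq0 : 0 ≤ q := h.nonneg y hy r hr
      have hpq : q ≤ p := by nlinarith [mul_pos hφ1 hD0]
      have hpU : p ≤ U := hU x hx r hr
      have hp1 : g' p ≤ g' U := hg.monotoneOn (hq0.trans hpq) hU0 hpU
      have hp0 : 0 ≤ g' p := by linarith [hg.one_le p (hq0.trans hpq)]
      have hm : g' q ≤ g' p := hg.monotoneOn hq0 (hq0.trans hpq) hpq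
      have h1 : κ * (g p - g q) ≤ |κ| * (g' U * (φ * D)) := by
        refine mul_le_mul (le_abs_self _) ?_ (by linarith [hg.mono hq0 hpq]) (abs_nonneg _)
        have := hg.sub_le hq0 hpq
        rw [heq] at this
        exact this.trans (mul_le_mul_of_nonneg_right hp1 (by positivity))
      have h2 : κ * ((x - y) * g' p) ≤ |κ| * (g' U * D) := by
        refine mul_le_mul (le_abs_self _) ?_ (mul_nonneg (by linarith) hp0) (abs_nonneg _)
        rw [mul_comm]
        exact mul_le_mul hp1 (by linarith) (by linarith) hG
      have h3 : κ * y * (g' p - g' q) ≤ 0 :=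
        mul_nonpos_of_nonpos_of_nonneg (hκ y hy) (by linarith)
      have h4 : φ * (κ * ((x - y) * g' p) + κ * y * (g' p - g' q)) ≤ φ * (|κ| * (g' U * D)) :=
        mul_le_mul_of_nonneg_left (by linarith) hφ1.le
      have : 0 < φ * D := by positivity
      calc κ * (g p + x * g' p * φ) - κ * (g q + y * g' q * φ)
          = κ * (g p - g q) + φ * (κ * ((x - y) * g' p) + κ * y * (g' p - g' q)) := by ring
        _ ≤ |κ| * (g' U * (φ * D)) + φ * (|κ| * (g' U * D)) := by linarith
        _ < C * φ * D := by rw [hC]; nlinarith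
  have hlim : Tendsto (fun e => φ₀ * Real.exp (C * (t - c)) * (x - y + e)) (𝓝[>] 0)
      (𝓝 (φ₀ * Real.exp (C * (t - c)) * (x - y + 0))) :=
    (Continuous.tendsto (by fun_prop) 0).mono_left nhdsWithin_le_nhds
  have h1 : u x t - u y t ≤ φ₀ * Real.exp (C * (t - c)) * (x - y + 0) :=
    ge_of_tendsto hlim (by filter_upwards [self_mem_nhdsWithin] with e he using (main e he).le)
  rw [add_zero] at h1
  refine h1.trans ?_
  gcongr
  exact ht.2

theorem upper_slope_of_short (hg : IsFlux g g')
    (h : TransportSolution g g' κ a b c d u ux Λ E)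
    (hu : ContinuousOn (fun p : ℝ × ℝ => u p.1 p.2) (Icc a b ×ˢ Icc c d)) {U K X φ₀ r e : ℝ}
    (hX : ∀ x ∈ Icc a b, |x| ≤ X) (hU0 : 0 ≤ U)
    (hU : ∀ x ∈ Icc a b, ∀ t ∈ Icc c d, u x t ≤ U)
    (hK0 : 0 ≤ K) (hK : ∀ v ∈ Icc 0 U, ∀ w ∈ Icc 0 U, |g' v - g' w| ≤ K * |v - w|)
    (he : 0 < e) (h0 : ∀ x ∈ Icc a b, ∀ y ∈ Icc a b, y ≤ x → u x c - u y c < φ₀ * (x - y + e))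
    (hΛ : Λ < φ₀) (hr : |κ| * (4 * g' U * φ₀ + 4 * X * K * φ₀ ^ 2) < r)
    (hdc : r * (d - c) ≤ φ₀) :
    ∀ t ∈ Icc c d, ∀ x ∈ Icc a b, ∀ y ∈ Icc a b, y ≤ x →
      u x t - u y t ≤ 2 * φ₀ * (x - y + e) := by
  intro t ht x hx y hy hyx
  have hG : 0 ≤ g' U := by linarith [hg.one_le U hU0]
  have hφ0 : 0 < φ₀ := (abs_nonneg _).trans_lt ((h.slope_left t ht).trans_lt hΛ)
  have hX0 : 0 ≤ X := (abs_nonneg _).trans (hX x hx)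
  have hr0 : 0 < r := lt_of_le_of_lt (by positivity) hr
  have hφle : ∀ s ∈ Icc c d, φ₀ ≤ φ₀ + r * (s - c) ∧ φ₀ + r * (s - c) ≤ 2 * φ₀ := by
    intro s hs
    have h1 : 0 ≤ r * (s - c) := mul_nonneg hr0.le (by linarith [hs.1])
    have h2 : r * (s - c) ≤ r * (d - c) := mul_le_mul_of_nonneg_left (by linarith [hs.2]) hr0.le
    constructor <;> linarith
  have main := h.two_point_slope hu (φ := fun t => φ₀ + r * (t - c)) (φ' := fun _ => r)
    (fun s hs => by
      simpa using (((hasDerivAt_id s).sub_const c).const_mul r).const_add φ₀)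
    (fun s hs => hΛ.trans_le (hφle s hs).1) he (by simpa using h0)
    (fun s hs x hx y hy hyx heq => ?_) t ht x hx y hy hyx
  · exact main.le.trans (mul_le_mul_of_nonneg_right (hφle t ht).2 (by linarith))
  · obtain ⟨hφ1, hφ2⟩ := hφle s hs
    beta_reduce at heq ⊢
    set φ := φ₀ + r * (s - c) with hφ
    set p := u x s
    set q := u y s
    set D := x - y + e with hD
    have hD0 : 0 < D := by linarith
    have hq0 : 0 ≤ q := h.nonneg y hy s hs
    have hφ3 : 0 < φ := by linarith
    have hpq : q ≤ p := by nlinarith [mul_pos hφ3 hD0]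
    have hpU : p ≤ U := hU x hx s hs
    have hp1 : g' p ≤ g' U := hg.monotoneOn (hq0.trans hpq) hU0 hpU
    have hp0 : 0 ≤ g' p := by linarith [hg.one_le p (hq0.trans hpq)]
    have hm : g' q ≤ g' p := hg.monotoneOn hq0 (hq0.trans hpq) hpq
    have h1 : κ * (g p - g q) ≤ |κ| * (g' U * (φ * D)) := by
      refine mul_le_mul (le_abs_self _) ?_ (by linarith [hg.mono hq0 hpq]) (abs_nonneg _)
      have := hg.sub_le hq0 hpq
      rw [heq] at this
      exact this.trans (mul_le_mul_of_nonneg_right hp1 (by positivity))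
    have h2 : κ * ((x - y) * g' p) ≤ |κ| * (g' U * D) := by
      refine mul_le_mul (le_abs_self _) ?_ (mul_nonneg (by linarith) hp0) (abs_nonneg _)
      rw [mul_comm]
      exact mul_le_mul hp1 (by linarith) (by linarith) hG
    have h3 : κ * (y * (g' p - g' q)) ≤ |κ| * (X * (K * (φ * D))) := by
      refine (le_abs_self _).trans ?_
      rw [abs_mul, abs_mul]
      refine mul_le_mul_of_nonneg_left ?_ (abs_nonneg _)
      refine mul_le_mul (hX y hy) ?_ (abs_nonneg _) hX0
      have := hK p ⟨hq0.trans hpq, hpU⟩ q ⟨hq0, hpq.trans hpU⟩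
      rwa [heq, abs_of_nonneg (by positivity : 0 ≤ φ * D)] at this
    have h4 : φ * (κ * ((x - y) * g' p) + κ * (y * (g' p - g' q))) ≤
        φ * (|κ| * (g' U * D) + |κ| * (X * (K * (φ * D)))) :=
      mul_le_mul_of_nonneg_left (by linarith) hφ3.le
    have h5 : |κ| * (2 * g' U * φ + X * K * φ ^ 2) ≤
        |κ| * (4 * g' U * φ₀ + 4 * X * K * φ₀ ^ 2) := by
      refine mul_le_mul_of_nonneg_left ?_ (abs_nonneg _)
      have a1 : 2 * g' U * φ ≤ 2 * g' U * (2 * φ₀) :=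
        mul_le_mul_of_nonneg_left hφ2 (by positivity)
      have a2 : X * K * φ ^ 2 ≤ X * K * (2 * φ₀) ^ 2 :=
        mul_le_mul_of_nonneg_left (by gcongr) (by positivity)
      linarith
    calc κ * (g p + x * g' p * φ) - κ * (g q + y * g' q * φ)
        = κ * (g p - g q) + φ * (κ * ((x - y) * g' p) + κ * (y * (g' p - g' q))) := by ring
      _ ≤ |κ| * (g' U * (φ * D)) + φ * (|κ| * (g' U * D) + |κ| * (X * (K * (φ * D)))) := by
        linarith
      _ = |κ| * (2 * g' U * φ + X * K * φ ^ 2) * D := by ring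
      _ < r * D := mul_lt_mul_of_pos_right (by linarith) hD0

theorem eventually_abs_sub_le_of_nonneg (hg : IsFlux g g')
    (h : TransportSolution g g' κ a b c d u ux Λ E) (hcd : c < d) (hab : a ≤ b) {s m X n η : ℝ}
    (hm : 0 < m) (hs : ∀ x ∈ Icc a b, m ≤ s * x ∧ s * x ≤ X)
    (hκ : ∀ x ∈ Icc a b, 0 ≤ κ * x) (hn : SlopeBound (fun x => u x c) a b n)
    (hloc : ∀ r ∈ Ioc c d, ∃ L, ∀ t ∈ Icc r d, SlopeBound (fun x => u x t) a b L)
    (hη : 0 < η) :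
    ∀ᶠ t in 𝓝[Ioc c d] c, ∀ x ∈ Icc a b, |u x t - u x c| ≤ η := by
  have hd : d ∈ Icc c d := ⟨hcd.le, le_rfl⟩
  obtain ⟨L, hL⟩ := hloc d ⟨hcd, le_rfl⟩
  have hLd := (hL d ⟨le_rfl, le_rfl⟩).mono (le_abs_self L)
  set U₀ := E + |L| * (b - a) with hU₀
  have hba : 0 ≤ |L| * (b - a) := mul_nonneg (abs_nonneg _) (by linarith)
  have hE := h.edge_left d hd
  have hu0 := h.nonneg a ⟨le_rfl, hab⟩ d hd
  have hXm : m ≤ X := (hs a ⟨le_rfl, hab⟩).1.trans (hs a ⟨le_rfl, hab⟩).2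
  set U := X * g U₀ / m with hU
  have hU0 : 0 ≤ U := div_nonneg (mul_nonneg (by linarith) (hg.nonneg (by linarith))) hm.le
  set φ₀ := max L Λ + 1
  have key : ∀ t ∈ Ioc c d, ∀ x ∈ Icc a b, ∀ y ∈ Icc a b, y ≤ x →
      u x t - u y t ≤ φ₀ * Real.exp ((2 * |-κ| * g' U + 1) * (d - c)) * (x - y) := by
    intro t ht x hx y hy hyx
    have hr := (h.restrict ht.1.le le_rfl).timeReverse
    obtain ⟨L', hL'⟩ := hloc t ht
    have hcont : ContinuousOn (fun p : ℝ × ℝ => u p.1 (-p.2)) (Icc a b ×ˢ Icc (-d) (-t)) :=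
      SlopeBound.continuousOn_prod (u := fun x t => u x (-t)) (L := L')
        (fun x hx => hr.continuousOn_t hx)
        fun s hs => hL' _ ⟨by linarith [hs.2], by linarith [hs.1]⟩
    have hbd := hr.le_of_initial_le hg hcont hm hs hab (U := U₀) (by linarith) fun x hx => by
      have := hLd.le_add (abs_nonneg _) hx
      simp only [neg_neg] at this ⊢
      linarith
    have := hr.upper_slope_of_nonpos hg hcont (n := L) (φ₀ := φ₀)
      (fun x hx => by linarith [hκ x hx]) hU0 hbd
      (by simpa using hL d ⟨le_rfl, le_rfl⟩) (by linarith [le_max_left L Λ])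
      (by linarith [le_max_right L Λ]) (-t) ⟨by linarith [ht.2], le_rfl⟩ x hx y hy hyx
    simp only [neg_neg] at this
    refine this.trans ?_
    have hφ0 : 0 ≤ φ₀ := by
      have := (abs_nonneg _).trans (h.slope_left d hd)
      linarith [le_max_right L Λ]
    have := hg.one_le U hU0
    gcongr φ₀ * Real.exp ((2 * |-κ| * g' U + 1) * ?_) * (x - y)
    linarith [ht.1]
  refine eventually_forall_abs_sub_le (fun x hx => ?_)
    (by filter_upwards [self_mem_nhdsWithin] with t ht using key t ht) hn hη
  exact (h.continuousOn_t hx c ⟨le_rfl, hcd.le⟩).mono_left (nhdsWithin_mono _ Ioc_subset_Icc_self)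

theorem eventually_abs_sub_le (hg : IsFlux g g')
    (h : TransportSolution g g' κ a b c d u ux Λ E) (hcd : c < d) (hab : a ≤ b) {s m X n η : ℝ}
    (hm : 0 < m) (hs : ∀ x ∈ Icc a b, m ≤ s * x ∧ s * x ≤ X)
    (hκ : (∀ x ∈ Icc a b, 0 ≤ κ * x) ∨ ∀ x ∈ Icc a b, κ * x ≤ 0)
    (hn : SlopeBound (fun x => u x c) a b n)
    (hloc : ∀ r ∈ Ioc c d, ∃ L, ∀ t ∈ Icc r d, SlopeBound (fun x => u x t) a b L)
    (hη : 0 < η) :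
    ∀ᶠ t in 𝓝[Ioc c d] c, ∀ x ∈ Icc a b, |u x t - u x c| ≤ η := by
  rcases hκ with hκ | hκ
  · exact h.eventually_abs_sub_le_of_nonneg hg hcd hab hm hs hκ hn hloc hη
  · have hmem : ∀ x ∈ Icc (-b) (-a), -x ∈ Icc a b := fun x hx =>
      ⟨by linarith [hx.2], by linarith [hx.1]⟩
    have := h.reflect.eventually_abs_sub_le_of_nonneg hg hcd (by linarith) (s := -s) hm
      (fun x hx => by simpa using hs _ (hmem x hx)) (fun x hx => by linarith [hκ _ (hmem x hx)])
      hn.reflect (fun r hr => (hloc r hr).imp fun L hL t ht => (hL t ht).reflect) hη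
    filter_upwards [this] with t ht x hx
    simpa using ht (-x) ⟨by linarith [hx.2], by linarith [hx.1]⟩

theorem upper_slope_of_eventually (hg : IsFlux g g')
    (h : TransportSolution g g' κ a b c d u ux Λ E) (hcd : c < d) {n U K X φ₀ r : ℝ}
    (hX : ∀ x ∈ Icc a b, |x| ≤ X) (hU0 : 0 ≤ U)
    (hU : ∀ x ∈ Icc a b, ∀ t ∈ Icc c d, u x t ≤ U)
    (hK0 : 0 ≤ K) (hK : ∀ v ∈ Icc 0 U, ∀ w ∈ Icc 0 U, |g' v - g' w| ≤ K * |v - w|)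
    (hn : SlopeBound (fun x => u x c) a b n)
    (hloc : ∀ r ∈ Ioc c d, ∃ L, ∀ t ∈ Icc r d, SlopeBound (fun x => u x t) a b L)
    (hev : ∀ η > 0, ∀ᶠ t in 𝓝[Ioc c d] c, ∀ x ∈ Icc a b, |u x t - u x c| ≤ η)
    (hφ₀ : 0 < φ₀) (hnφ : n ≤ φ₀) (hΛ : Λ < φ₀)
    (hr0 : 0 ≤ r) (hr : |κ| * (4 * g' U * φ₀ + 4 * X * K * φ₀ ^ 2) < r)
    (hdc : r * (d - c) ≤ φ₀) :
    ∀ t ∈ Icc c d, ∀ x ∈ Icc a b, ∀ y ∈ Icc a b, y ≤ x → u x t - u y t ≤ 2 * φ₀ * (x - y) := by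
  intro t ht x hx y hy hyx
  have := left_nhdsWithin_Ioc_neBot hcd
  rcases ht.1.eq_or_lt with rfl | hct
  · refine (hn.sub_le hx hy hyx).trans (mul_le_mul_of_nonneg_right (by linarith) (by linarith))
  have main : ∀ e > 0, u x t - u y t ≤ 2 * φ₀ * (x - y + e) := by
    intro e he
    have h2 : ∀ᶠ s in 𝓝[Ioc c d] c, s < t := mem_nhdsWithin_of_mem_nhds (Iio_mem_nhds hct)
    obtain ⟨q, hq1, hq2, hq3⟩ :=
      ((hev (φ₀ * e / 3) (by positivity)).and (h2.and self_mem_nhdsWithin)).exists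
    obtain ⟨L, hL⟩ := hloc q hq3
    have hres := h.restrict hq3.1.le le_rfl
    refine hres.upper_slope_of_short hg
      (SlopeBound.continuousOn_prod (fun x hx => hres.continuousOn_t hx) hL) hX hU0
      (fun x hx t ht => hU x hx t ⟨hq3.1.le.trans ht.1, ht.2⟩) hK0 hK he
      (fun x hx y hy hyx => ?_) hΛ hr ?_ t ⟨hq2.le, ht.2⟩ x hx y hy hyx
    · have h3 := abs_le.1 (hq1 x hx)
      have h4 := abs_le.1 (hq1 y hy)
      have h5 := hn.sub_le hx hy hyx
      have h6 : n * (x - y) ≤ φ₀ * (x - y) := mul_le_mul_of_nonneg_right hnφ (by linarith)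
      have : 0 < φ₀ * e := by positivity
      linarith
    · exact (mul_le_mul_of_nonneg_left (by linarith [hq3.1]) hr0).trans hdc
  have hlim : Tendsto (fun e => 2 * φ₀ * (x - y + e)) (𝓝[>] 0) (𝓝 (2 * φ₀ * (x - y + 0))) :=
    (Continuous.tendsto (by fun_prop) 0).mono_left nhdsWithin_le_nhds
  have h1 := ge_of_tendsto hlim (by filter_upwards [self_mem_nhdsWithin] with e he using main e he)
  rwa [add_zero] at h1

theorem exists_slopeBound_right (hg : IsFlux g g') (hab : a ≤ b) {s m X : ℝ} (hm : 0 < m)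
    (hs : ∀ x ∈ Icc a b, m ≤ s * x ∧ s * x ≤ X) (hs1 : |s| = 1)
    (hκ : (∀ x ∈ Icc a b, 0 ≤ κ * x) ∨ ∀ x ∈ Icc a b, κ * x ≤ 0) (n : ℝ) (Λ E : ℝ) :
    ∃ τ > 0, ∃ N, ∀ c d u ux, c < d → d - c ≤ τ →
      TransportSolution g g' κ a b c d u ux Λ E → SlopeBound (fun x => u x c) a b n →
      (∀ r ∈ Ioc c d, ∃ L, ∀ t ∈ Icc r d, SlopeBound (fun x => u x t) a b L) →
      ∀ t ∈ Icc c d, SlopeBound (fun x => u x t) a b N := by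
  have hXm : m ≤ X := (hs a ⟨le_rfl, hab⟩).1.trans (hs a ⟨le_rfl, hab⟩).2
  have hX : ∀ x ∈ Icc a b, |x| ≤ X := by
    intro x hx
    rw [← one_mul |x|, ← hs1, ← abs_mul, abs_of_nonneg (hm.le.trans (hs x hx).1)]
    exact (hs x hx).2
  set U₀ := |E| + |n| * (b - a) + 1 with hU₀
  have hnb : 0 ≤ |n| * (b - a) := mul_nonneg (abs_nonneg _) (by linarith)
  have hU₀0 : 0 ≤ U₀ := by positivity
  set U := X * g U₀ / m with hU
  have hUU : U₀ ≤ U := by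
    rw [hU, le_div_iff₀ hm, mul_comm]
    exact mul_le_mul hXm (hg.self_le _ hU₀0) hU₀0 (by linarith)
  have hU0 : 0 ≤ U := hU₀0.trans hUU
  obtain ⟨K, hK0, hK⟩ := hg.lipschitz U
  set φ₀ := |n| + |Λ| + 1 with hφ₀
  have hφ0 : 0 < φ₀ := by positivity
  have hG := hg.one_le U hU0
  set r := |κ| * (4 * g' U * φ₀ + 4 * X * K * φ₀ ^ 2) + 1 with hr
  have hX0 : 0 ≤ X := by linarith
  have hr0 : 0 < r := by positivity
  refine ⟨φ₀ / r, by positivity, 2 * φ₀, fun c d u ux hcd hτ h hn hloc => ?_⟩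
  have hev : ∀ η > 0, ∀ᶠ t in 𝓝[Ioc c d] c, ∀ x ∈ Icc a b, |u x t - u x c| ≤ η :=
    fun η hη => h.eventually_abs_sub_le hg hcd hab hm hs hκ hn hloc hη
  have hne := left_nhdsWithin_Ioc_neBot hcd
  have hc0 : ∀ x ∈ Icc a b, u x c ≤ U₀ - 1 := by
    intro x hx
    have := (hn.mono (le_abs_self n)).le_add (abs_nonneg _) hx
    linarith [h.edge_left c ⟨le_rfl, hcd.le⟩, le_abs_self E]
  have hbd : ∀ x ∈ Icc a b, ∀ t ∈ Icc c d, u x t ≤ U := by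
    intro x hx t ht
    rcases ht.1.eq_or_lt with rfl | hct
    · linarith [hc0 x hx]
    have h2 : ∀ᶠ s in 𝓝[Ioc c d] c, s < t := mem_nhdsWithin_of_mem_nhds (Iio_mem_nhds hct)
    obtain ⟨q, hq1, hq2, hq3⟩ := ((hev 1 one_pos).and (h2.and self_mem_nhdsWithin)).exists
    obtain ⟨L, hL⟩ := hloc q hq3
    have hres := h.restrict hq3.1.le le_rfl
    refine hres.le_of_initial_le hg
      (SlopeBound.continuousOn_prod (fun x hx => hres.continuousOn_t hx) hL) hm hs hab
      (by linarith [le_abs_self E]) (fun x hx => ?_) x hx t ⟨hq2.le, ht.2⟩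
    linarith [(abs_le.1 (hq1 x hx)).2, hc0 x hx]
  have hdc : r * (d - c) ≤ φ₀ := by
    rw [le_div_iff₀ hr0] at hτ
    linarith
  have hmem : ∀ x ∈ Icc (-b) (-a), -x ∈ Icc a b := fun x hx =>
    ⟨by linarith [hx.2], by linarith [hx.1]⟩
  have hmem' : ∀ x ∈ Icc a b, -x ∈ Icc (-b) (-a) := fun x hx =>
    ⟨by linarith [hx.2], by linarith [hx.1]⟩
  have hnφ : n ≤ φ₀ := by linarith [le_abs_self n, abs_nonneg Λ]
  have hΛφ : Λ < φ₀ := by linarith [le_abs_self Λ, abs_nonneg n]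
  intro t ht
  refine slopeBound_of_le (h.upper_slope_of_eventually hg hcd hX hU0 hbd hK0 hK hn hloc hev hφ0
    hnφ hΛφ hr0.le (lt_add_one _) hdc t ht) fun x hx y hy hyx => ?_
  have := h.reflect.upper_slope_of_eventually hg hcd (X := X) (r := r)
    (fun x hx => by simpa using hX _ (hmem x hx)) hU0
    (fun x hx => hbd _ (hmem x hx)) hK0 hK hn.reflect
    (fun r hr => (hloc r hr).imp fun L hL t ht => (hL t ht).reflect)
    (fun η hη => by
      filter_upwards [hev η hη] with t ht x hx using ht _ (hmem x hx))
    hφ0 hnφ hΛφ hr0.le (lt_add_one _) hdc t ht (-y) (hmem' y hy) (-x) (hmem' x hx) (by linarith)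
  simp only [neg_neg] at this
  linarith

theorem exists_slopeBound_left (hg : IsFlux g g') (hab : a ≤ b) {s m X : ℝ} (hm : 0 < m)
    (hs : ∀ x ∈ Icc a b, m ≤ s * x ∧ s * x ≤ X) (hs1 : |s| = 1)
    (hκ : (∀ x ∈ Icc a b, 0 ≤ κ * x) ∨ ∀ x ∈ Icc a b, κ * x ≤ 0) (n : ℝ) (Λ E : ℝ) :
    ∃ τ > 0, ∃ N, ∀ c d u ux, c < d → d - c ≤ τ →
      TransportSolution g g' κ a b c d u ux Λ E → SlopeBound (fun x => u x d) a b n →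
      (∀ r ∈ Ico c d, ∃ L, ∀ t ∈ Icc c r, SlopeBound (fun x => u x t) a b L) →
      ∀ t ∈ Icc c d, SlopeBound (fun x => u x t) a b N := by
  obtain ⟨τ, hτ, N, hN⟩ := exists_slopeBound_right (κ := -κ) hg hab hm hs hs1
    (by simpa [or_comm] using hκ) n Λ E
  refine ⟨τ, hτ, N, fun c d u ux hcd hdc h hn hloc t ht => ?_⟩
  have := hN (-d) (-c) _ _ (by linarith) (by linarith) h.timeReverse (by simpa using hn)
    (fun r hr => (hloc (-r) ⟨by linarith [hr.2], by linarith [hr.1]⟩).imp fun L hL t ht =>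
      hL (-t) ⟨by linarith [ht.2], by linarith [ht.1]⟩)
    (-t) ⟨by linarith [ht.2], by linarith [ht.1]⟩
  simpa using this

end TransportSolution

theorem exists_slopeBound_of_locally {u : ℝ → ℝ → ℝ} {a b p q : ℝ}
    (h : ∀ t ∈ Icc p q, ∃ ε > 0, ∃ L, ∀ r ∈ Icc p q, |r - t| < ε →
      SlopeBound (fun x => u x r) a b L) :
    ∃ L, ∀ t ∈ Icc p q, SlopeBound (fun x => u x t) a b L := by
  refine (isCompact_Icc (a := p) (b := q)).induction_on
    (p := fun s => ∃ L, ∀ t ∈ s, SlopeBound (fun x => u x t) a b L)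
    ⟨0, by simp⟩ (fun s t hst ⟨L, hL⟩ => ⟨L, fun r hr => hL r (hst hr)⟩)
    (fun s t ⟨L, hL⟩ ⟨M, hM⟩ => ⟨max L M, fun r hr => hr.elim
      (fun hr => (hL r hr).mono (le_max_left _ _))
      (fun hr => (hM r hr).mono (le_max_right _ _))⟩) fun t ht => ?_
  obtain ⟨ε, hε, L, hL⟩ := h t ht
  refine ⟨Icc p q ∩ Metric.ball t ε,
    inter_mem self_mem_nhdsWithin (mem_nhdsWithin_of_mem_nhds (Metric.ball_mem_nhds _ hε)),
    L, fun r hr => hL r hr.1 ?_⟩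
  simpa [Real.dist_eq] using hr.2

namespace TransportSolution

variable {g g' : ℝ → ℝ} {κ a b c d Λ E : ℝ} {u ux : ℝ → ℝ → ℝ}

theorem exists_slopeBound (hg : IsFlux g g')
    (h : TransportSolution g g' κ a b c d u ux Λ E) (hab : a ≤ b) {s m X : ℝ} (hm : 0 < m)
    (hs : ∀ x ∈ Icc a b, m ≤ s * x ∧ s * x ≤ X) (hs1 : |s| = 1)
    (hκ : (∀ x ∈ Icc a b, 0 ≤ κ * x) ∨ ∀ x ∈ Icc a b, κ * x ≤ 0)
    (hpt : ∀ t ∈ Icc c d, ∃ L, SlopeBound (fun x => u x t) a b L) :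
    ∃ L, ∀ t ∈ Icc c d, SlopeBound (fun x => u x t) a b L := by
  set Good : ℝ → Prop := fun t => ∃ ε > 0, ∃ L, ∀ r ∈ Icc c d, |r - t| < ε →
    SlopeBound (fun x => u x r) a b L with hGood
  suffices hall : ∀ t ∈ Icc c d, Good t from exists_slopeBound_of_locally hall
  by_contra! hbad
  have hopen : IsOpen {t | Good t} := by
    refine Metric.isOpen_iff.2 fun t ⟨ε, hε, L, hL⟩ => ⟨ε / 2, half_pos hε, fun r hr => ?_⟩
    refine ⟨ε / 2, half_pos hε, L, fun q hq hqr => hL q hq ?_⟩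
    rw [Metric.mem_ball, Real.dist_eq] at hr
    have := abs_sub_le q r t
    linarith
  set Q : Set ℝ := Icc c d ∩ {t | Good t}ᶜ with hQ
  have hQc : IsCompact Q := isCompact_Icc.inter_right hopen.isClosed_compl
  obtain ⟨tb, htb, htb'⟩ := hbad
  have : Nonempty Q := ⟨⟨tb, htb, htb'⟩⟩
  have : CompactSpace Q := isCompact_iff_compactSpace.1 hQc
  obtain ⟨n, ⟨t₀, ht₀Q⟩, hii⟩ := nonempty_interior_of_iUnion_of_closed
    (f := fun n : ℕ => {t : Q | SlopeBound (fun x => u x t) a b n}) (fun n => by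
      simp only [SlopeBound, ofPred_forall]
      refine isClosed_biInter fun x hx => isClosed_biInter fun y hy => isClosed_le ?_ (by fun_prop)
      exact (((h.continuousOn_t hx).comp_continuous continuous_subtype_val fun t => t.2.1).sub
        ((h.continuousOn_t hy).comp_continuous continuous_subtype_val fun t => t.2.1)).abs)
    (by
      refine eq_univ_of_forall fun t => ?_
      obtain ⟨L, hL⟩ := hpt t t.2.1
      obtain ⟨n, hn⟩ := exists_nat_ge L
      exact mem_iUnion.2 ⟨n, hL.mono hn⟩)
  obtain ⟨ε, hε, hball⟩ := Metric.mem_nhds_iff.1 (mem_interior_iff_mem_nhds.1 hii)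
  have hn : ∀ t ∈ Q, |t - t₀| < ε → SlopeBound (fun x => u x t) a b n := fun t ht htε =>
    hball (a := ⟨t, ht⟩) (by simpa [Metric.mem_ball, Subtype.dist_eq, Real.dist_eq] using htε)
  obtain ⟨τ₁, hτ₁, N₁, hN₁⟩ := exists_slopeBound_right (κ := κ) hg hab hm hs hs1 hκ n Λ E
  obtain ⟨τ₂, hτ₂, N₂, hN₂⟩ := exists_slopeBound_left (κ := κ) hg hab hm hs hs1 hκ n Λ E
  have hloc : ∀ p q, Icc p q ⊆ Icc c d → (∀ t ∈ Icc p q, t ∉ Q) →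
      ∃ L, ∀ t ∈ Icc p q, SlopeBound (fun x => u x t) a b L := by
    intro p q hpq hpqQ
    refine exists_slopeBound_of_locally fun t ht => ?_
    have : Good t := by
      by_contra hc
      exact hpqQ t ht ⟨hpq ht, hc⟩
    obtain ⟨ε', hε', L, hL⟩ := this
    exact ⟨ε', hε', L, fun r hr => hL r (hpq hr)⟩
  refine ht₀Q.2 ⟨min ε (min τ₁ τ₂), lt_min hε (lt_min hτ₁ hτ₂), max n (max N₁ N₂),
    fun r hr hrt => ?_⟩
  have hr1 := hrt.trans_le (min_le_left _ _)
  have hr2 := hrt.trans_le ((min_le_right _ _).trans (min_le_left _ _))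
  have hr3 := hrt.trans_le ((min_le_right _ _).trans (min_le_right _ _))
  by_cases hrQ : r ∈ Q
  · exact (hn r hrQ hr1).mono (le_max_left _ _)
  rcases lt_or_gt_of_ne (fun hc : t₀ = r => hrQ (hc ▸ ht₀Q)) with hlt | hlt
  · rw [abs_of_pos (sub_pos.2 hlt)] at hr1 hr2
    have hne : (Q ∩ Icc t₀ r).Nonempty := ⟨t₀, ht₀Q, le_rfl, hlt.le⟩
    have hcomp : IsCompact (Q ∩ Icc t₀ r) := hQc.inter isCompact_Icc
    obtain ⟨hsQ, hs1, hs2⟩ := hcomp.sSup_mem hne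
    set σ := sSup (Q ∩ Icc t₀ r)
    have hσr : σ < r := lt_of_le_of_ne hs2 fun hc => hrQ (hc ▸ hsQ)
    refine (hN₁ σ r u ux hσr (by linarith) (h.restrict hsQ.1.1 hr.2) (hn σ hsQ ?_)
      (fun q hq => hloc q r (Icc_subset_Icc (hsQ.1.1.trans hq.1.le) hr.2) fun t ht htQ => ?_)
      r ⟨hσr.le, le_rfl⟩).mono ((le_max_left _ _).trans (le_max_right _ _))
    · rw [abs_of_nonneg (by linarith)]; linarith
    · have := le_csSup hcomp.bddAbove ⟨htQ, hs1.trans (hq.1.le.trans ht.1), ht.2⟩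
      exact absurd (hq.1.trans_le ht.1) (not_lt.2 this)
  · rw [abs_of_neg (sub_neg.2 hlt)] at hr1 hr3
    have hne : (Q ∩ Icc r t₀).Nonempty := ⟨t₀, ht₀Q, hlt.le, le_rfl⟩
    have hcomp : IsCompact (Q ∩ Icc r t₀) := hQc.inter isCompact_Icc
    obtain ⟨hsQ, hs1, hs2⟩ := hcomp.sInf_mem hne
    set σ := sInf (Q ∩ Icc r t₀)
    have hσr : r < σ := lt_of_le_of_ne hs1 fun hc => hrQ (hc ▸ hsQ)
    refine (hN₂ r σ u ux hσr (by linarith) (h.restrict hr.1 hsQ.1.2) (hn σ hsQ ?_)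
      (fun q hq => hloc r q (Icc_subset_Icc hr.1 (hq.2.le.trans hsQ.1.2)) fun t ht htQ => ?_)
      r ⟨le_rfl, hσr.le⟩).mono ((le_max_right _ _).trans (le_max_right _ _))
    · rw [abs_of_nonpos (by linarith)]; linarith
    · have := csInf_le hcomp.bddBelow ⟨htQ, ht.1, ht.2.trans (hq.2.le.trans hs2)⟩
      exact absurd (ht.2.trans_lt hq.2) (not_lt.2 this)

end TransportSolution

theorem IsFlux.continuousOn_deriv {g g' : ℝ → ℝ} (hg : IsFlux g g') (U : ℝ) :
    ContinuousOn g' (Icc 0 U) := by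
  obtain ⟨K, hK0, hK⟩ := hg.lipschitz U
  exact (LipschitzOnWith.of_dist_le_mul (K := ⟨K, hK0⟩) fun v hv w hw =>
    hK v hv w hw).continuousOn

namespace TransportSolution

variable {g g' : ℝ → ℝ} {κ a b c d Λ E : ℝ} {u ux : ℝ → ℝ → ℝ}

theorem continuousOn_x (h : TransportSolution g g' κ a b c d u ux Λ E) {t : ℝ}
    (ht : t ∈ Icc c d) : ContinuousOn (fun x => u x t) (Icc a b) :=
  fun x hx => (h.deriv_x x hx t ht).continuousAt.continuousWithinAt

theorem abs_deriv_le (h : TransportSolution g g' κ a b c d u ux Λ E) {L t : ℝ}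
    (hL : SlopeBound (fun x => u x t) a b L) (ht : t ∈ Icc c d) {x : ℝ} (hx : x ∈ Icc a b) :
    |ux x t| ≤ max |L| Λ := by
  rcases hx.1.eq_or_lt with rfl | hax
  · exact (h.slope_left t ht).trans (le_max_right _ _)
  rcases hx.2.eq_or_lt with rfl | hxb
  · exact (h.slope_right t ht).trans (le_max_right _ _)
  refine le_max_of_le_left ((h.deriv_x x hx t ht).le_of_lip' (abs_nonneg L) ?_)
  filter_upwards [Icc_mem_nhds hax hxb] with y hy
  exact (hL.mono (le_abs_self L)) y hy x hx

theorem exists_bound (h : TransportSolution g g' κ a b c d u ux Λ E) {L : ℝ}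
    (hL : ∀ t ∈ Icc c d, SlopeBound (fun x => u x t) a b L) :
    ∃ U, 0 ≤ U ∧ ∀ x ∈ Icc a b, ∀ t ∈ Icc c d, u x t ≤ U := by
  obtain ⟨U, hU⟩ := (isCompact_Icc.prod isCompact_Icc).exists_bound_of_continuousOn
    (SlopeBound.continuousOn_prod (fun x hx => h.continuousOn_t hx) hL)
  exact ⟨|U|, abs_nonneg _, fun x hx t ht =>
    (le_abs_self _).trans ((hU (x, t) ⟨hx, ht⟩).trans (le_abs_self U))⟩

theorem continuousOn_integral_mul (h : TransportSolution g g' κ a b c d u ux Λ E)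
    (hab : a ≤ b) {L : ℝ} (hL : ∀ t ∈ Icc c d, SlopeBound (fun x => u x t) a b L) {φ : ℝ → ℝ}
    (hφ : Continuous φ) : ContinuousOn (fun t => ∫ x in a..b, φ x * u x t) (Icc c d) := by
  obtain ⟨U, hU0, hU⟩ := h.exists_bound hL
  intro t ht
  refine intervalIntegral.continuousWithinAt_of_dominated_interval (bound := fun x => |φ x| * U)
    ?_ ?_ ?_ ?_
  · filter_upwards [self_mem_nhdsWithin] with s hs
    rw [uIoc_of_le hab]
    exact ((hφ.continuousOn.mul (h.continuousOn_x hs)).mono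
      Ioc_subset_Icc_self).aestronglyMeasurable measurableSet_Ioc
  · filter_upwards [self_mem_nhdsWithin] with s hs
    refine ae_of_all _ fun x hx => ?_
    rw [uIoc_of_le hab] at hx
    have hx' := Ioc_subset_Icc_self hx
    rw [Real.norm_eq_abs, abs_mul, abs_of_nonneg (h.nonneg x hx' s hs)]
    exact mul_le_mul_of_nonneg_left (hU x hx' s hs) (abs_nonneg _)
  · exact Continuous.intervalIntegrable (by fun_prop) _ _
  · refine ae_of_all _ fun x hx => ?_
    rw [uIoc_of_le hab] at hx
    exact continuousWithinAt_const.mul (h.continuousOn_t (Ioc_subset_Icc_self hx) t ht)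

theorem hasDerivAt_integral_mul (hg : IsFlux g g')
    (h : TransportSolution g g' κ a b c d u ux Λ E) (hab : a ≤ b) {L : ℝ}
    (hL : ∀ t ∈ Icc c d, SlopeBound (fun x => u x t) a b L)
    (hux : ∀ t ∈ Icc c d, ContinuousOn (fun x => ux x t) (Icc a b)) {φ φ' : ℝ → ℝ}
    (hφ : ∀ x, HasDerivAt φ (φ' x) x) (hφ' : Continuous φ') {t : ℝ} (ht : t ∈ Ioo c d) :
    HasDerivAt (fun t => ∫ x in a..b, φ x * u x t)
      (φ b * (κ * (b * g (u b t))) - φ a * (κ * (a * g (u a t))) -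
        ∫ x in a..b, φ' x * (κ * (x * g (u x t)))) t := by
  obtain ⟨U, hU0, hU⟩ := h.exists_bound hL
  have hφc : Continuous φ := continuous_iff_continuousAt.2 fun x => (hφ x).continuousAt
  have hsub : Ioc a b ⊆ Icc a b := Ioc_subset_Icc_self
  set P : ℝ → ℝ → ℝ := fun s x => κ * (g (u x s) + x * g' (u x s) * ux x s) with hP
  have hPc : ∀ s ∈ Icc c d, ContinuousOn (P s) (Icc a b) := by
    intro s hs
    have h1 := h.continuousOn_x hs
    have h2 : ContinuousOn (fun x => g (u x s)) (Icc a b) :=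
      hg.continuousOn.comp h1 fun x hx => h.nonneg x hx s hs
    have h3 : ContinuousOn (fun x => g' (u x s)) (Icc a b) :=
      (hg.continuousOn_deriv U).comp h1 fun x hx => ⟨h.nonneg x hx s hs, hU x hx s hs⟩
    exact continuousOn_const.mul (h2.add ((continuousOn_id.mul h3).mul (hux s hs)))
  have ht' := Ioo_subset_Icc_self ht
  have hXmax : ∀ x ∈ Icc a b, |x| ≤ |a| + |b| := fun x hx => by
    rw [abs_le]
    constructor <;> linarith [neg_abs_le a, le_abs_self b, abs_nonneg a, abs_nonneg b, hx.1, hx.2]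
  have key := intervalIntegral.hasDerivAt_integral_of_dominated_loc_of_deriv_le (μ := volume)
    (a := a) (b := b) (F := fun t x => φ x * u x t) (F' := fun t x => φ x * P t x) (x₀ := t)
    (bound := fun x => |φ x| * (|κ| * (g U + (|a| + |b|) * g' U * max |L| Λ)))
    (Ioo_mem_nhds ht.1 ht.2) (by
      filter_upwards [Ioo_mem_nhds ht.1 ht.2] with s hs
      rw [uIoc_of_le hab]
      exact ((hφc.continuousOn.mul (h.continuousOn_x (Ioo_subset_Icc_self hs))).mono
        hsub).aestronglyMeasurable measurableSet_Ioc)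
    (ContinuousOn.intervalIntegrable (by
      rw [uIcc_of_le hab]
      exact hφc.continuousOn.mul (h.continuousOn_x ht')))
    (by
      rw [uIoc_of_le hab]
      exact ((hφc.continuousOn.mul (hPc t ht')).mono hsub).aestronglyMeasurable measurableSet_Ioc)
    (ae_of_all _ fun x hx s hs => by
      rw [uIoc_of_le hab] at hx
      have hx' := hsub hx
      have hs' := Ioo_subset_Icc_self hs
      have h0 := h.nonneg x hx' s hs'
      have h1 := hU x hx' s hs'
      have h2 := hg.one_le _ h0
      rw [Real.norm_eq_abs, abs_mul, hP, abs_mul]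
      refine mul_le_mul_of_nonneg_left (mul_le_mul_of_nonneg_left ?_ (abs_nonneg _)) (abs_nonneg _)
      refine (abs_add_le _ _).trans (add_le_add ?_ ?_)
      · rw [abs_of_nonneg (hg.nonneg h0)]
        exact hg.mono h0 h1
      · rw [abs_mul, abs_mul, abs_of_nonneg (by linarith : 0 ≤ g' (u x s))]
        exact mul_le_mul (mul_le_mul (hXmax x hx') (hg.monotoneOn h0 hU0 h1) (by linarith)
          (by positivity)) (h.abs_deriv_le (hL s hs') hs' hx') (abs_nonneg _)
          (mul_nonneg (by positivity) (by linarith [hg.one_le U hU0])))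
    (Continuous.intervalIntegrable (by fun_prop) _ _)
    (ae_of_all _ fun x hx s hs => by
      rw [uIoc_of_le hab] at hx
      exact ((h.deriv_t x (hsub hx) s (Ioo_subset_Icc_self hs)).hasDerivAt
        (Icc_mem_nhds hs.1 hs.2)).const_mul _)
  refine key.2.congr_deriv ?_
  refine intervalIntegral.integral_mul_deriv_eq_deriv_mul (u := φ) (u' := φ')
    (v := fun x => κ * (x * g (u x t))) (fun x _ => hφ x) (fun x hx => ?_)
    (hφ'.intervalIntegrable _ _)
    (ContinuousOn.intervalIntegrable (by rw [uIcc_of_le hab]; exact hPc t ht'))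
  rw [uIcc_of_le hab] at hx
  refine (((hasDerivAt_id x).mul ((hg.hasDerivAt _ (h.nonneg x hx t ht')).comp x
    (h.deriv_x x hx t ht'))).const_mul κ).congr_deriv ?_
  simp only [hP, id_eq, Function.comp_apply]
  ring

end TransportSolution

/-- A solution of `∂ₜu = κ ∂ₓ(x g(u))` for times in `[0, T]` that vanishes on `[R, ∞)`. -/
structure HalfLineSolution (g g' : ℝ → ℝ) (κ R T : ℝ) (u : ℝ → ℝ → ℝ) : Prop where
  nonneg : ∀ x, ∀ t ∈ Icc 0 T, 0 ≤ u x t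
  eq_zero : ∀ x, R ≤ x → ∀ t ∈ Icc 0 T, u x t = 0
  contDiff_x : ∀ t ∈ Icc 0 T, ContDiff ℝ 1 (fun x => u x t)
  contDiffOn_t : ∀ x, ContDiffOn ℝ 1 (u x) (Icc 0 T)
  deriv_t : ∀ x, ∀ t ∈ Icc 0 T, HasDerivWithinAt (u x)
    (κ * (g (u x t) + x * g' (u x t) * deriv (fun y => u y t) x)) (Icc 0 T) t

namespace HalfLineSolution

variable {g g' : ℝ → ℝ} {κ R T : ℝ} {u : ℝ → ℝ → ℝ}

theorem exists_bound_t (h : HalfLineSolution g g' κ R T u) (x : ℝ) :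
    ∃ U, 0 ≤ U ∧ ∀ t ∈ Icc 0 T, u x t ≤ U := by
  obtain ⟨U, hU⟩ := isCompact_Icc.exists_bound_of_continuousOn (h.contDiffOn_t x).continuousOn
  exact ⟨|U|, abs_nonneg _, fun t ht => (le_abs_self _).trans ((hU t ht).trans (le_abs_self U))⟩

theorem exists_abs_deriv_le (hg : IsFlux g g') (h : HalfLineSolution g g' κ R T u) (hT : 0 < T)
    (hκ : 0 < κ) {x : ℝ} (hx : 0 < x) :
    ∃ Λ, ∀ t ∈ Icc 0 T, |deriv (fun y => u y t) x| ≤ Λ := by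
  obtain ⟨U, hU0, hU⟩ := h.exists_bound_t x
  obtain ⟨M, hM⟩ := isCompact_Icc.exists_bound_of_continuousOn
    ((h.contDiffOn_t x).continuousOn_derivWithin (uniqueDiffOn_Icc hT) le_rfl)
  refine ⟨(M + κ * g U) / (κ * x), fun t ht => ?_⟩
  have h1 := hM t ht
  rw [(h.deriv_t x t ht).derivWithin (uniqueDiffOn_Icc hT t ht), Real.norm_eq_abs, abs_le] at h1
  have hu := h.nonneg x t ht
  have h2 := mul_le_mul_of_nonneg_left (hg.mono hu (hU t ht)) hκ.le
  have h3 := mul_nonneg hκ.le (hg.nonneg hu)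
  have h4 := hg.one_le _ hu
  set p := deriv (fun y => u y t) x
  have h5 : |κ * x * g' (u x t) * p| ≤ M + κ * g U := by
    rw [abs_le]
    constructor <;> linarith
  rw [le_div_iff₀ (by positivity)]
  refine le_trans ?_ h5
  rw [abs_mul, abs_of_pos (by positivity : 0 < κ * x * g' (u x t)), mul_comm]
  refine mul_le_mul_of_nonneg_right (le_mul_of_one_le_right (by positivity) h4) (abs_nonneg _)

theorem exists_transport (hg : IsFlux g g') (h : HalfLineSolution g g' κ R T u) (hT : 0 < T)
    (hκ : 0 < κ) {a b : ℝ} (ha : 0 < a) (hab : a ≤ b) :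
    ∃ Λ E L, TransportSolution g g' κ a b 0 T u (fun x t => deriv (fun y => u y t) x) Λ E ∧
      ∀ t ∈ Icc 0 T, SlopeBound (fun x => u x t) a b L := by
  obtain ⟨Λ₁, h₁⟩ := h.exists_abs_deriv_le hg hT hκ ha
  obtain ⟨Λ₂, h₂⟩ := h.exists_abs_deriv_le hg hT hκ (ha.trans_le hab)
  obtain ⟨U₁, -, hU₁⟩ := h.exists_bound_t a
  obtain ⟨U₂, -, hU₂⟩ := h.exists_bound_t b
  have key : TransportSolution g g' κ a b 0 T u (fun x t => deriv (fun y => u y t) x)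
      (max Λ₁ Λ₂) (max U₁ U₂) :=
    ⟨fun x _ => h.nonneg x,
      fun x _ t ht => ((h.contDiff_x t ht).differentiable (by simp) x).hasDerivAt,
      fun x _ => h.deriv_t x, fun t ht => (h₁ t ht).trans (le_max_left _ _),
      fun t ht => (h₂ t ht).trans (le_max_right _ _),
      fun t ht => (hU₁ t ht).trans (le_max_left _ _),
      fun t ht => (hU₂ t ht).trans (le_max_right _ _)⟩
  obtain ⟨L, hL⟩ := key.exists_slopeBound hg hab ha (s := 1) (X := b)
    (fun x hx => by simpa using hx) (by simp)
    (Or.inl fun x hx => mul_nonneg hκ.le (ha.le.trans hx.1)) fun t ht => by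
      obtain ⟨K, hK⟩ := (h.contDiff_x t ht).contDiffOn.exists_lipschitzOnWith (s := Icc a b)
        (by simp) (convex_Icc a b) isCompact_Icc
      exact ⟨K, fun x hx y hy => hK.dist_le_mul x hx y hy⟩
  exact ⟨_, _, L, key, hL⟩

theorem exists_flux_le (hg : IsFlux g g') (hg0 : g 0 = 0) (h : HalfLineSolution g g' κ R T u)
    (hT : 0 < T) (hκ : 0 < κ) :
    ∃ K, 0 ≤ K ∧ ∀ x ∈ Ioc 0 R, ∀ t ∈ Icc 0 T, x * g (u x t) ≤ K := by
  have h0 : (0 : ℝ) ∈ Icc 0 T := ⟨le_rfl, hT.le⟩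
  obtain ⟨K, hK⟩ := (isCompact_Icc (a := 0) (b := R)).exists_bound_of_continuousOn
    (f := fun x => x * g (u x 0)) (continuousOn_id.mul (hg.continuousOn.comp
      (h.contDiff_x 0 h0).continuous.continuousOn fun x _ => h.nonneg x 0 h0))
  refine ⟨|K|, abs_nonneg _, fun x hx t ht => ?_⟩
  obtain ⟨Λ, E, L, hu, hL⟩ := h.exists_transport hg hT hκ hx.1 hx.2
  simpa using hu.max_principle hg (s := 1) (K := |K|)
    (SlopeBound.continuousOn_prod (fun x hx => hu.continuousOn_t hx) hL)
    (fun y hy => by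
      have := hK y ⟨hx.1.le.trans hy.1, hy.2⟩
      simpa using (le_abs_self _).trans (this.trans (le_abs_self K)))
    (Or.inl (mul_pos hκ hx.1)) (fun s hs => by simp [h.eq_zero R le_rfl s hs, hg0])
    x ⟨le_rfl, hx.2⟩ t ht

theorem eventually_mass_ge (hg : IsFlux g g') (hg0 : g 0 = 0) (h : HalfLineSolution g g' κ R T u)
    (hR : 0 < R) (hT : 0 < T) (hκ : 0 < κ) {η : ℝ} (hη : 0 < η) :
    ∀ᶠ ε in 𝓝[>] (0 : ℝ), ∀ t ∈ Icc 0 T, (∫ x in 0..R, u x 0) - η ≤ ∫ x in ε..R, u x t := by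
  have h0 : (0 : ℝ) ∈ Icc 0 T := ⟨le_rfl, hT.le⟩
  obtain ⟨K, hK0, hK⟩ := h.exists_flux_le hg hg0 hT hκ
  have hψc : ∀ ε, ContinuousOn (fun t => κ * (ε * g (u ε t))) (Icc 0 T) := fun ε =>
    continuousOn_const.mul (continuousOn_const.mul (hg.continuousOn.comp
      (h.contDiffOn_t ε).continuousOn fun t ht => h.nonneg ε t ht))
  have hεR : ∀ᶠ ε in 𝓝[>] (0 : ℝ), ε ∈ Ioc 0 R := Ioc_mem_nhdsGT hR
  have hlim : Tendsto (fun ε => ∫ t in 0..T, κ * (ε * g (u ε t))) (𝓝[>] 0) (𝓝 0) := by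
    have := intervalIntegral.tendsto_integral_filter_of_dominated_convergence (μ := volume)
      (a := 0) (b := T) (F := fun ε t => κ * (ε * g (u ε t))) (f := fun _ => (0 : ℝ))
      (l := 𝓝[>] (0 : ℝ)) (fun _ => κ * K)
      (Eventually.of_forall fun ε => by
        rw [uIoc_of_le hT.le]
        exact ((hψc ε).mono Ioc_subset_Icc_self).aestronglyMeasurable measurableSet_Ioc)
      (by
        filter_upwards [hεR] with ε hε
        refine ae_of_all _ fun t ht => ?_
        rw [uIoc_of_le hT.le] at ht
        have ht' := Ioc_subset_Icc_self ht
        rw [Real.norm_of_nonneg (mul_nonneg hκ.le (mul_nonneg hε.1.le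
          (hg.nonneg (h.nonneg ε t ht'))))]
        exact mul_le_mul_of_nonneg_left (hK ε hε t ht') hκ.le)
      intervalIntegrable_const
      (ae_of_all _ fun t ht => by
        rw [uIoc_of_le hT.le] at ht
        have ht' := Ioc_subset_Icc_self ht
        have hc : Continuous fun x => κ * (x * g (u x t)) :=
          continuous_const.mul (continuous_id.mul (hg.continuousOn.comp_continuous
            (h.contDiff_x t ht').continuous fun x => h.nonneg x t ht'))
        have := hc.tendsto 0
        simp only [zero_mul, mul_zero] at this
        exact this.mono_left nhdsWithin_le_nhds)
    simpa using this
  have hii : ∀ p q : ℝ, IntervalIntegrable (fun x => u x 0) volume p q := fun p q =>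
    (h.contDiff_x 0 h0).continuous.intervalIntegrable p q
  have hlim' : Tendsto (fun ε => ∫ x in 0..ε, u x 0) (𝓝[>] 0) (𝓝 0) := by
    have := (intervalIntegral.continuous_primitive hii 0).tendsto 0
    rw [intervalIntegral.integral_same] at this
    exact this.mono_left nhdsWithin_le_nhds
  filter_upwards [hεR, hlim.eventually_lt_const (half_pos hη),
    hlim'.eventually_lt_const (half_pos hη)] with ε hε h1 h2 t ht
  obtain ⟨Λ, E, L, hu, hL⟩ := h.exists_transport hg hT hκ hε.1 hε.2
  have hd : ∀ s ∈ Ioo 0 t, HasDerivAt (fun t => ∫ x in ε..R, u x t) (-(κ * (ε * g (u ε s)))) s :=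
    fun s hs => by
      have := hu.hasDerivAt_integral_mul hg hε.2 hL
        (fun t ht => ((h.contDiff_x t ht).continuous_deriv le_rfl).continuousOn)
        (φ := fun _ => 1) (φ' := fun _ => 0) (fun x => hasDerivAt_const x 1) continuous_const
        ⟨hs.1, hs.2.trans_le ht.2⟩
      simpa [h.eq_zero R le_rfl s ⟨hs.1.le, hs.2.le.trans ht.2⟩, hg0] using this
  have hts : Icc 0 t ⊆ Icc 0 T := Icc_subset_Icc le_rfl ht.2
  have hMc : ContinuousOn (fun t => ∫ x in ε..R, u x t) (Icc 0 T) := by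
    simpa using hu.continuousOn_integral_mul hε.2 hL (φ := fun _ => 1) continuous_const
  have hψi : ∀ p ∈ Icc 0 T, ∀ q ∈ Icc 0 T,
      IntervalIntegrable (fun t => κ * (ε * g (u ε t))) volume p q := fun p hp q hq =>
    ((hψc ε).mono (ordConnected_Icc.uIcc_subset hp hq)).intervalIntegrable
  have hT' : T ∈ Icc 0 T := ⟨hT.le, le_rfl⟩
  have hsub := intervalIntegral.integral_eq_sub_of_hasDerivAt_of_le ht.1 (hMc.mono hts) hd
    (hψi 0 h0 t ht).neg
  rw [intervalIntegral.integral_neg] at hsub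
  have hadd := intervalIntegral.integral_add_adjacent_intervals (hψi 0 h0 t ht) (hψi t ht T hT')
  have hpos : 0 ≤ ∫ s in t..T, κ * (ε * g (u ε s)) :=
    intervalIntegral.integral_nonneg ht.2 fun s hs => mul_nonneg hκ.le (mul_nonneg hε.1.le
      (hg.nonneg (h.nonneg ε s ⟨ht.1.trans hs.1, hs.2⟩)))
  have hadd' := intervalIntegral.integral_add_adjacent_intervals (hii 0 ε) (hii ε R)
  linarith

theorem continuousOn_moment (hg : IsFlux g g') (h : HalfLineSolution g g' κ R T u) (hT : 0 < T)
    (hκ : 0 < κ) {ε : ℝ} (hε : ε ∈ Ioc 0 R) :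
    ContinuousOn (fun t => ∫ x in ε..R, x ^ 2 * u x t) (Icc 0 T) := by
  obtain ⟨Λ, E, L, hu, hL⟩ := h.exists_transport hg hT hκ hε.1 hε.2
  exact hu.continuousOn_integral_mul hε.2 hL (by fun_prop)

theorem exists_hasDerivAt_moment (hg : IsFlux g g') (hg0 : g 0 = 0)
    (h : HalfLineSolution g g' κ R T u) (hT : 0 < T) (hκ : 0 < κ) {ε : ℝ} (hε : ε ∈ Ioc 0 R)
    {t : ℝ} (ht : t ∈ Ioo 0 T) :
    ∃ D ≤ -(2 * κ * ∫ x in ε..R, x ^ 2 * g (u x t)),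
      HasDerivAt (fun t => ∫ x in ε..R, x ^ 2 * u x t) D t := by
  obtain ⟨Λ, E, L, hu, hL⟩ := h.exists_transport hg hT hκ hε.1 hε.2
  have ht' := Ioo_subset_Icc_self ht
  refine ⟨_, ?_, hu.hasDerivAt_integral_mul hg hε.2 hL
        (fun t ht => ((h.contDiff_x t ht).continuous_deriv le_rfl).continuousOn)
        (φ := fun x => x ^ 2) (φ' := fun x => 2 * x) (fun x => by simpa using hasDerivAt_pow 2 x)
        (by fun_prop) ht⟩
  have h1 : ∀ x, 2 * x * (κ * (x * g (u x t))) = 2 * κ * (x ^ 2 * g (u x t)) := fun x => by ring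
  simp only [h1, intervalIntegral.integral_const_mul, h.eq_zero R le_rfl t ht', hg0]
  have h2 : 0 ≤ ε ^ 2 * (κ * (ε * g (u ε t))) := mul_nonneg (sq_nonneg _) (mul_nonneg hκ.le
    (mul_nonneg hε.1.le (hg.nonneg (h.nonneg ε t ht'))))
  linarith

end HalfLineSolution

theorem le_rpow_young {α τ x v : ℝ} (hα : 0 < α) (hτ : 0 < τ) (hx : 0 < x) (hv : 0 ≤ v) :
    v ≤ τ ^ (-α) / (α + 1) * (x ^ 2 * v ^ (α + 1)) + τ * (α / (α + 1)) * x ^ (-(2 / α)) := by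
  have hpq : (α + 1).HolderConjugate ((α + 1) / α) := by
    rw [Real.holderConjugate_iff]
    refine ⟨by linarith, ?_⟩
    field_simp
    ring
  have h1 := Real.young_inequality_of_nonneg
    (a := τ ^ (-(α / (α + 1))) * x ^ (2 / (α + 1)) * v)
    (b := τ ^ (α / (α + 1)) * x ^ (-(2 / (α + 1)))) (by positivity) (by positivity) hpq
  rw [Real.mul_rpow (by positivity) hv, Real.mul_rpow (by positivity) (by positivity),
    Real.mul_rpow (by positivity) (by positivity), ← Real.rpow_mul hτ.le, ← Real.rpow_mul hx.le,
    ← Real.rpow_mul hτ.le, ← Real.rpow_mul hx.le] at h1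
  have e1 : -(α / (α + 1)) * (α + 1) = -α := by field_simp
  have e2 : 2 / (α + 1) * (α + 1) = (2 : ℕ) := by field_simp; norm_num
  have e3 : α / (α + 1) * ((α + 1) / α) = 1 := by field_simp
  have e4 : -(2 / (α + 1)) * ((α + 1) / α) = -(2 / α) := by field_simp
  rw [e1, e2, e3, e4, Real.rpow_one, Real.rpow_natCast] at h1
  have e5 : τ ^ (-(α / (α + 1))) * x ^ (2 / (α + 1)) * v *
      (τ ^ (α / (α + 1)) * x ^ (-(2 / (α + 1)))) = v := by
    have a1 : τ ^ (-(α / (α + 1))) * τ ^ (α / (α + 1)) = 1 := by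
      rw [← Real.rpow_add hτ]; simp
    have a2 : x ^ (2 / (α + 1)) * x ^ (-(2 / (α + 1))) = 1 := by
      rw [← Real.rpow_add hx]; simp
    linear_combination (x ^ (2 / (α + 1)) * x ^ (-(2 / (α + 1))) * v) * a1 + v * a2
  rw [e5] at h1
  refine h1.trans (le_of_eq ?_)
  field_simp

theorem integral_le_young {α τ r ε R : ℝ} (hα : 2 < α) (hτ : 0 < τ) (hr : 0 < r) (hε : 0 < ε)
    (hεR : ε ≤ R) {v : ℝ → ℝ} (hv : Continuous v) (hv0 : ∀ x, 0 ≤ v x) :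
    ∫ x in ε..R, v x ≤ τ ^ (-α) / (α + 1) * (∫ x in ε..R, x ^ 2 * v x ^ (α + 1)) +
      τ * (α / (α + 1)) * (cConst α / 2 * r ^ (1 - 2 / α)) +
      r ^ (-2 : ℝ) * ∫ x in ε..R, x ^ 2 * v x := by
  have hexp : -1 < -(2 / α) := by
    rw [neg_lt_neg_iff, div_lt_one (by linarith)]; exact hα
  have hI : IntervalIntegrable (fun x : ℝ => x ^ (-(2 / α))) volume 0 r :=
    intervalIntegral.intervalIntegrable_rpow' hexp
  have hIv : ∫ x in 0..r, x ^ (-(2 / α)) = cConst α / 2 * r ^ (1 - 2 / α) := by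
    rw [integral_rpow (Or.inl hexp), Real.zero_rpow (by linarith), cConst]
    have : α - 2 ≠ 0 := by linarith
    have h0 : -(2 / α) + 1 = 1 - 2 / α := by ring
    have h1 : 1 - 2 / α = (α - 2) / α := by field_simp
    rw [h0, sub_zero, h1]
    field_simp
  set w : ℝ → ℝ := (Iic r).indicator fun x => x ^ (-(2 / α)) with hw
  have hset : ∀ x ∈ Ioc ε R ∩ Iic r, x ∈ Ioc 0 r := fun x hx => ⟨hε.trans hx.1.1, hx.2⟩
  have hwi : IntegrableOn w (Ioc ε R) := by
    rw [hw, IntegrableOn, integrable_indicator_iff measurableSet_Iic, IntegrableOn,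
      Measure.restrict_restrict measurableSet_Iic, inter_comm]
    exact ((intervalIntegrable_iff_integrableOn_Ioc_of_le hr.le).1 hI).mono_set hset
  have hwI : IntervalIntegrable w volume ε R :=
    (intervalIntegrable_iff_integrableOn_Ioc_of_le hεR).2 hwi
  have hwle : ∫ x in ε..R, w x ≤ cConst α / 2 * r ^ (1 - 2 / α) := by
    rw [← hIv, intervalIntegral.integral_of_le hεR, intervalIntegral.integral_of_le hr.le, hw,
      setIntegral_indicator measurableSet_Iic]
    refine setIntegral_mono_set ((intervalIntegrable_iff_integrableOn_Ioc_of_le hr.le).1 hI) ?_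
      (LE.le.eventuallyLE hset)
    filter_upwards [ae_restrict_mem measurableSet_Ioc] with x hx
    exact Real.rpow_nonneg hx.1.le _
  have hc1 : Continuous fun x => x ^ 2 * v x ^ (α + 1) :=
    (continuous_id.pow 2).mul (hv.rpow_const fun x => Or.inr (by linarith))
  have hc2 : Continuous fun x => x ^ 2 * v x := (continuous_id.pow 2).mul hv
  have i1 := (hc1.intervalIntegrable (μ := volume) ε R).const_mul (τ ^ (-α) / (α + 1))
  have i2 := hwI.const_mul (τ * (α / (α + 1)))
  have i3 := (hc2.intervalIntegrable (μ := volume) ε R).const_mul (r ^ (-2 : ℝ))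
  have hmono := intervalIntegral.integral_mono_on hεR (hv.intervalIntegrable ε R)
    ((i1.add i2).add i3) fun x hx => ?_
  · rw [intervalIntegral.integral_add (i1.add i2) i3, intervalIntegral.integral_add i1 i2,
      intervalIntegral.integral_const_mul, intervalIntegral.integral_const_mul,
      intervalIntegral.integral_const_mul] at hmono
    refine hmono.trans ?_
    gcongr
  · have hx0 : 0 < x := hε.trans_le hx.1
    have hvx := hv0 x
    by_cases hxr : x ≤ r
    · have h1 := le_rpow_young (α := α) (by linarith) hτ hx0 hvx
      have h2 : 0 ≤ r ^ (-2 : ℝ) * (x ^ 2 * v x) := by positivity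
      have h3 : w x = x ^ (-(2 / α)) := indicator_of_mem (s := Iic r) hxr _
      simp only [h3]
      linarith
    · have h3 : w x = 0 := indicator_of_notMem (s := Iic r) hxr _
      have h4 : 0 ≤ τ ^ (-α) / (α + 1) * (x ^ 2 * v x ^ (α + 1)) := by positivity
      have h5 : v x ≤ r ^ (-2 : ℝ) * (x ^ 2 * v x) := by
        rw [Real.rpow_neg hr.le, Real.rpow_two, ← div_eq_inv_mul, le_div_iff₀ (by positivity),
          mul_comm]
        exact mul_le_mul_of_nonneg_right (by nlinarith [not_le.1 hxr]) hvx
      simp only [h3]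
      linarith

theorem cConst_gt_two {α : ℝ} (hα : 2 < α) : 2 < cConst α := by
  rw [cConst, lt_div_iff₀ (by linarith)]
  linarith

theorem one_le_dConst {α : ℝ} (hα : 2 < α) : 1 ≤ dConst α := by
  refine Real.one_le_rpow ?_ (by norm_num)
  have : α - 2 ≠ 0 := by linarith
  rw [cConst, div_mul_cancel₀ _ this, le_div_iff₀ (by linarith)]
  linarith

theorem dissipation_lower_bound {α z V₀ I V m : ℝ} (hα : 2 < α) (hz : 0 < z) (hV₀ : 0 < V₀)
    (hV : V ≤ V₀) {S τ : ℝ} (hS : S = (V₀ / z) ^ (1 / 2 : ℝ)) (hτ : τ = z * S ^ (2 / α - 1))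
    (hm : z * (cConst α * dConst α + dConst α ^ (-2 : ℝ)) -
      z * (cConst α * dConst α - 1) / (2 * (α + 1)) ≤ m)
    (hmI : m ≤ τ ^ (-α) / (α + 1) * I +
      τ * (α / (α + 1)) * (cConst α * (dConst α * S) ^ (1 - 2 / α)) +
      (dConst α * S) ^ (-2 : ℝ) * V) :
    τ ^ α * z * ((cConst α * dConst α + 1) / 2) ≤ I := by
  have hc := cConst_gt_two hα
  have hd := one_le_dConst hα
  set c := cConst α
  set d := dConst α
  have hS0 : 0 < S := by rw [hS]; positivity
  have hτ0 : 0 < τ := by rw [hτ]; positivity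
  have hd0 : 0 < d := by linarith
  have hα0 : 0 < α := by linarith
  have e1 : S ^ (-2 : ℝ) * V₀ = z := by
    rw [hS, ← Real.rpow_mul (by positivity)]
    norm_num
    rw [Real.rpow_neg_one]
    field_simp
  have h1 : (d * S) ^ (-2 : ℝ) * V ≤ d ^ (-2 : ℝ) * z := by
    rw [Real.mul_rpow hd0.le hS0.le, mul_assoc]
    refine mul_le_mul_of_nonneg_left ?_ (by positivity)
    calc S ^ (-2 : ℝ) * V ≤ S ^ (-2 : ℝ) * V₀ := by gcongr
      _ = z := e1
  have h2 : τ * (d * S) ^ (1 - 2 / α) ≤ z * d := by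
    rw [Real.mul_rpow hd0.le hS0.le, hτ]
    have e2 : S ^ (2 / α - 1) * S ^ (1 - 2 / α) = 1 := by
      rw [← Real.rpow_add hS0]; simp
    have e3 : z * S ^ (2 / α - 1) * (d ^ (1 - 2 / α) * S ^ (1 - 2 / α)) = z * d ^ (1 - 2 / α) := by
      linear_combination (z * d ^ (1 - 2 / α)) * e2
    rw [e3]
    refine mul_le_mul_of_nonneg_left ?_ hz.le
    refine (Real.rpow_le_rpow_of_exponent_le hd (y := 1 - 2 / α) (z := 1) ?_).trans_eq
      (Real.rpow_one d)
    have : 0 < 2 / α := by positivity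
    linarith
  have h3 : τ * (α / (α + 1)) * (c * (d * S) ^ (1 - 2 / α)) ≤ z * d * c * (α / (α + 1)) := by
    calc τ * (α / (α + 1)) * (c * (d * S) ^ (1 - 2 / α)) =
        τ * (d * S) ^ (1 - 2 / α) * (c * (α / (α + 1))) := by ring
      _ ≤ z * d * (c * (α / (α + 1))) := by gcongr
      _ = _ := by ring
  have h4 : z * ((c * d + 1) / 2) / (α + 1) ≤ τ ^ (-α) / (α + 1) * I := by
    have e4 : z * c * d - z * d * c * (α / (α + 1)) - z * (c * d - 1) / (2 * (α + 1)) =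
        z * ((c * d + 1) / 2) / (α + 1) := by field_simp; ring
    rw [← e4]
    linarith
  rw [div_mul_eq_mul_div, div_le_div_iff_of_pos_right (by linarith)] at h4
  have e5 : τ ^ α * τ ^ (-α) = 1 := by
    rw [← Real.rpow_add hτ0]; simp
  calc τ ^ α * z * ((c * d + 1) / 2) = τ ^ α * (z * ((c * d + 1) / 2)) := by ring
    _ ≤ τ ^ α * (τ ^ (-α) * I) := by gcongr
    _ = I := by rw [← mul_assoc, e5, one_mul]

theorem div_tau_rpow_mul_eq {α z V₀ : ℝ} (hα : 0 < α) (hz : 0 < z) (hV₀ : 0 < V₀) {S τ : ℝ}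
    (hS : S = (V₀ / z) ^ (1 / 2 : ℝ)) (hτ : τ = z * S ^ (2 / α - 1)) :
    V₀ / (τ ^ α * z) = V₀ ^ (α / 2) / z ^ (3 * α / 2) := by
  have e : τ ^ α = z ^ α * (V₀ ^ (1 - α / 2) / z ^ (1 - α / 2)) := by
    rw [hτ, Real.mul_rpow hz.le (by rw [hS]; positivity), hS, ← Real.rpow_mul (by positivity),
      ← Real.rpow_mul (by positivity), Real.div_rpow hV₀.le hz.le]
    congr 2 <;> congr 1 <;> field_simp
  have e1 : V₀ = V₀ ^ (α / 2) * V₀ ^ (1 - α / 2) := by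
    rw [← Real.rpow_add hV₀]; simp
  have e2 : z ^ α * z = z ^ (3 * α / 2) * z ^ (1 - α / 2) := by
    nth_rewrite 2 [← Real.rpow_one z]
    rw [← Real.rpow_add hz, ← Real.rpow_add hz]
    ring_nf
  have p1 : 0 < V₀ ^ (1 - α / 2) := by positivity
  have p2 : 0 < z ^ (1 - α / 2) := by positivity
  have p3 : 0 < z ^ (3 * α / 2) := by positivity
  rw [e, div_eq_div_iff (by positivity) p3.ne']
  have e3 : z ^ α * (V₀ ^ (1 - α / 2) / z ^ (1 - α / 2)) * z =
      V₀ ^ (1 - α / 2) * z ^ (3 * α / 2) := by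
    rw [show z ^ α * (V₀ ^ (1 - α / 2) / z ^ (1 - α / 2)) * z =
      (z ^ α * z) * V₀ ^ (1 - α / 2) / z ^ (1 - α / 2) by ring, e2]
    field_simp
  rw [e3]
  linear_combination z ^ (3 * α / 2) * e1

theorem isFlux_rpow {α β : ℝ} (hα : 1 < α) (hβ : 0 < β) :
    IsFlux (fun v => v + β * v ^ (α + 1)) (fun v => 1 + β * (α + 1) * v ^ α) where
  hasDerivAt v _ := by
    refine ((hasDerivAt_id v).add ((Real.hasDerivAt_rpow_const (x := v) (p := α + 1)
      (Or.inr (by linarith))).const_mul β)).congr_deriv ?_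
    rw [add_sub_cancel_right, mul_assoc]
  one_le v hv := by
    have : 0 ≤ β * (α + 1) * v ^ α := by positivity
    linarith
  monotoneOn v hv w _ hvw := by
    have hv' : 0 ≤ v := hv
    dsimp only
    gcongr
  lipschitz U := by
    refine ⟨β * (α + 1) * (α * |U| ^ (α - 1)), by positivity, fun v hv w hw => ?_⟩
    have h1 : |v ^ α - w ^ α| ≤ α * |U| ^ (α - 1) * |v - w| := by
      refine (convex_Icc 0 U).norm_image_sub_le_of_norm_deriv_le (𝕜 := ℝ) (f := fun v => v ^ α)
        (fun x _ => (Real.hasDerivAt_rpow_const (Or.inr hα.le)).differentiableAt) (fun x hx => ?_) hw hv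
      rw [(Real.hasDerivAt_rpow_const (Or.inr hα.le)).deriv,
        Real.norm_of_nonneg (mul_nonneg (by linarith) (Real.rpow_nonneg hx.1 _))]
      refine mul_le_mul_of_nonneg_left ?_ (by linarith)
      exact Real.rpow_le_rpow hx.1 (hx.2.trans (le_abs_self U)) (by linarith)
    have h2 : (1 + β * (α + 1) * v ^ α) - (1 + β * (α + 1) * w ^ α) =
        β * (α + 1) * (v ^ α - w ^ α) := by ring
    rw [h2, abs_mul, abs_of_pos (by positivity : 0 < β * (α + 1)), mul_assoc _ _ |v - w|]
    exact mul_le_mul_of_nonneg_left h1 (by positivity)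
  self_le v hv := by
    have : 0 ≤ β * v ^ (α + 1) := by positivity
    linarith

namespace HalfLineSolution

variable {α β κ R T : ℝ} {u v : ℝ → ℝ → ℝ}

theorem exists_hasDerivAt_moment_rpow (hα : 1 < α) (hβ : 0 < β) (hκ : 0 < κ) (hT : 0 < T)
    (h : HalfLineSolution (fun v => v + β * v ^ (α + 1)) (fun v => 1 + β * (α + 1) * v ^ α)
      κ R T u) {ε : ℝ} (hε : ε ∈ Ioc 0 R) {t : ℝ} (ht : t ∈ Ioo 0 T) :
    ∃ D ≤ -(2 * κ * β * ∫ x in ε..R, x ^ 2 * u x t ^ (α + 1)),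
      HasDerivAt (fun t => ∫ x in ε..R, x ^ 2 * u x t) D t := by
  obtain ⟨D, hD, hD'⟩ := h.exists_hasDerivAt_moment (isFlux_rpow hα hβ)
    (by simp [Real.zero_rpow (by linarith : α + 1 ≠ 0)]) hT hκ hε ht
  refine ⟨D, hD.trans ?_, hD'⟩
  have ht' := Ioo_subset_Icc_self ht
  have hc := (h.contDiff_x t ht').continuous
  have hc1 : Continuous fun x => x ^ 2 * u x t ^ (α + 1) :=
    (continuous_id.pow 2).mul (hc.rpow_const fun x => Or.inr (by linarith))
  have hc2 : Continuous fun x => x ^ 2 * u x t := (continuous_id.pow 2).mul hc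
  have h1 : ∀ x, x ^ 2 * (u x t + β * u x t ^ (α + 1)) =
    x ^ 2 * u x t + β * (x ^ 2 * u x t ^ (α + 1)) := fun x => by ring
  simp only [h1]
  rw [intervalIntegral.integral_add (hc2.intervalIntegrable _ _)
    ((hc1.intervalIntegrable _ _).const_mul β), intervalIntegral.integral_const_mul]
  have h2 : 0 ≤ ∫ x in ε..R, x ^ 2 * u x t :=
    intervalIntegral.integral_nonneg hε.2 fun x _ => mul_nonneg (sq_nonneg _) (h.nonneg x t ht')
  have := mul_nonneg hκ.le h2
  linarith

theorem lifespan_lt (hα : 2 < α) (hβ : 0 < β) (hκ : 0 < κ) (hR : 0 < R) (hT : 0 < T)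
    (hu : HalfLineSolution (fun v => v + β * v ^ (α + 1)) (fun v => 1 + β * (α + 1) * v ^ α)
      κ R T u)
    (hv : HalfLineSolution (fun v => v + β * v ^ (α + 1)) (fun v => 1 + β * (α + 1) * v ^ α)
      κ R T v) {ρ V₀ : ℝ} (hρ : ρ = (∫ x in 0..R, u x 0) + ∫ x in 0..R, v x 0) (hρ0 : 0 < ρ)
    (hV : V₀ = (∫ x in 0..R, x ^ 2 * u x 0) + ∫ x in 0..R, x ^ 2 * v x 0) (hV0 : 0 < V₀) :
    T < (cConst α * dConst α + dConst α ^ (-2 : ℝ)) ^ (3 * α / 2) * V₀ ^ (α / 2) /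
      (2 * κ * β * ρ ^ (3 * α / 2)) := by
  have hα1 : 1 < α := by linarith
  have hα0 : 0 < α := by linarith
  have hc := cConst_gt_two hα
  have hd := one_le_dConst hα
  have hd0 : 0 < dConst α := by linarith
  have hcd : 1 < cConst α * dConst α := by nlinarith
  have hk0 : 0 < cConst α * dConst α + dConst α ^ (-2 : ℝ) := by positivity
  set k := cConst α * dConst α + dConst α ^ (-2 : ℝ)
  set z := ρ / k with hz
  have hz0 : 0 < z := by positivity
  have hzk : z * k = ρ := by rw [hz]; field_simp
  have h0 : (0 : ℝ) ∈ Icc 0 T := ⟨le_rfl, hT.le⟩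
  have hT' : T ∈ Icc 0 T := ⟨hT.le, le_rfl⟩
  have hg := isFlux_rpow hα1 hβ
  have hg0 : (fun v : ℝ => v + β * v ^ (α + 1)) 0 = 0 := by
    simp [Real.zero_rpow (by linarith : α + 1 ≠ 0)]
  obtain ⟨η, hη⟩ : ∃ η, η = z * (cConst α * dConst α - 1) / (4 * (α + 1)) := ⟨_, rfl⟩
  have hη0 : 0 < η := by
    rw [hη]; exact div_pos (mul_pos hz0 (by linarith)) (by linarith)
  obtain ⟨ε, ⟨hεu, hεv⟩, hε⟩ := (((hu.eventually_mass_ge hg hg0 hR hT hκ hη0).and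
    (hv.eventually_mass_ge hg hg0 hR hT hκ hη0)).and (Ioc_mem_nhdsGT hR)).exists
  obtain ⟨S, hS⟩ : ∃ S, S = (V₀ / z) ^ (1 / 2 : ℝ) := ⟨_, rfl⟩
  obtain ⟨τ, hτ⟩ : ∃ τ, τ = z * S ^ (2 / α - 1) := ⟨_, rfl⟩
  have hS0 : 0 < S := by rw [hS]; positivity
  have hτ0 : 0 < τ := by rw [hτ]; positivity
  set W : ℝ → ℝ := (fun t => ∫ x in ε..R, x ^ 2 * u x t) + fun t => ∫ x in ε..R, x ^ 2 * v x t
    with hW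
  set I : ℝ → ℝ := fun t => (∫ x in ε..R, x ^ 2 * u x t ^ (α + 1)) +
    ∫ x in ε..R, x ^ 2 * v x t ^ (α + 1) with hI
  have hWc : ContinuousOn W (Icc 0 T) := (hu.continuousOn_moment hg hT hκ hε).add
    (hv.continuousOn_moment hg hT hκ hε)
  have hWd : ∀ t ∈ Ioo 0 T, ∃ D ≤ -(2 * κ * β * I t), HasDerivAt W D t := fun t ht => by
    obtain ⟨D₁, h1, h1'⟩ := hu.exists_hasDerivAt_moment_rpow hα1 hβ hκ hT hε ht
    obtain ⟨D₂, h2, h2'⟩ := hv.exists_hasDerivAt_moment_rpow hα1 hβ hκ hT hε ht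
    refine ⟨D₁ + D₂, ?_, h1'.add h2'⟩
    simp only [hI]
    linarith
  have hI0 : ∀ t ∈ Icc 0 T, 0 ≤ I t := fun t ht => add_nonneg
    (intervalIntegral.integral_nonneg hε.2 fun x _ => mul_nonneg (sq_nonneg _)
      (Real.rpow_nonneg (hu.nonneg x t ht) _))
    (intervalIntegral.integral_nonneg hε.2 fun x _ => mul_nonneg (sq_nonneg _)
      (Real.rpow_nonneg (hv.nonneg x t ht) _))
  have hW0 : ∀ t ∈ Icc 0 T, 0 ≤ W t := fun t ht => add_nonneg
    (intervalIntegral.integral_nonneg hε.2 fun x _ => mul_nonneg (sq_nonneg _) (hu.nonneg x t ht))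
    (intervalIntegral.integral_nonneg hε.2 fun x _ => mul_nonneg (sq_nonneg _) (hv.nonneg x t ht))
  have hWV : W 0 ≤ V₀ := by
    have key : ∀ w : ℝ → ℝ, Continuous w → (∀ x, 0 ≤ w x) →
        ∫ x in ε..R, x ^ 2 * w x ≤ ∫ x in 0..R, x ^ 2 * w x := fun w hw hw0 => by
      have hc : Continuous fun x => x ^ 2 * w x := (continuous_id.pow 2).mul hw
      rw [← intervalIntegral.integral_add_adjacent_intervals (hc.intervalIntegrable 0 ε)
        (hc.intervalIntegrable ε R)]
      have : 0 ≤ ∫ x in 0..ε, x ^ 2 * w x := intervalIntegral.integral_nonneg hε.1.le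
        fun x _ => mul_nonneg (sq_nonneg _) (hw0 x)
      linarith
    rw [hV]
    exact add_le_add (key _ (hu.contDiff_x 0 h0).continuous fun x => hu.nonneg x 0 h0)
      (key _ (hv.contDiff_x 0 h0).continuous fun x => hv.nonneg x 0 h0)
  have hdiff : DifferentiableOn ℝ W (interior (Icc 0 T)) := fun t ht => by
    rw [interior_Icc] at ht
    obtain ⟨D, -, hD⟩ := hWd t ht
    exact hD.differentiableAt.differentiableWithinAt
  have hanti : AntitoneOn W (Icc 0 T) := antitoneOn_of_deriv_nonpos (convex_Icc 0 T) hWc hdiff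
    fun t ht => by
      rw [interior_Icc] at ht
      obtain ⟨D, hD, hD'⟩ := hWd t ht
      rw [hD'.deriv]
      have := mul_nonneg (mul_pos (mul_pos two_pos hκ) hβ).le (hI0 t (Ioo_subset_Icc_self ht))
      linarith
  have hIlow : ∀ t ∈ Icc 0 T, τ ^ α * z * ((cConst α * dConst α + 1) / 2) ≤ I t := fun t ht => by
    have yu := integral_le_young hα hτ0 (mul_pos hd0 hS0) hε.1 hε.2 (hu.contDiff_x t ht).continuous
      fun x => hu.nonneg x t ht
    have yv := integral_le_young hα hτ0 (mul_pos hd0 hS0) hε.1 hε.2 (hv.contDiff_x t ht).continuous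
      fun x => hv.nonneg x t ht
    refine dissipation_lower_bound hα hz0 hV0 ((hanti h0 ht ht.1).trans hWV) hS hτ
      (m := (∫ x in ε..R, u x t) + ∫ x in ε..R, v x t) ?_ ?_
    · have e : z * (cConst α * dConst α - 1) / (2 * (α + 1)) = 2 * η := by
        rw [hη]; field_simp; ring
      rw [e, hzk, hρ]
      linarith [hεu t ht, hεv t ht]
    · simp only [hI, hW, Pi.add_apply]
      linarith
  set Q := 2 * κ * β * (τ ^ α * z * ((cConst α * dConst α + 1) / 2)) with hQ
  have hmv := (convex_Icc 0 T).image_sub_le_mul_sub_of_deriv_le hWc hdiff (C := -Q)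
    (fun t ht => by
      rw [interior_Icc] at ht
      obtain ⟨D, hD, hD'⟩ := hWd t ht
      rw [hD'.deriv]
      refine hD.trans (neg_le_neg ?_)
      exact mul_le_mul_of_nonneg_left (hIlow t (Ioo_subset_Icc_self ht)) (by positivity))
    0 h0 T hT' hT.le
  have hP : 0 < 2 * κ * β * (τ ^ α * z) := by positivity
  have hQ' : 2 * κ * β * (τ ^ α * z) < Q := by
    have h1 : 1 < (cConst α * dConst α + 1) / 2 := by linarith
    rw [hQ]
    exact (lt_mul_of_one_lt_right hP h1).trans_eq (mul_assoc _ _ _)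
  have hfin : T < V₀ / (2 * κ * β * (τ ^ α * z)) := by
    rw [lt_div_iff₀ hP]
    have := mul_lt_mul_of_pos_left hQ' hT
    linarith [hW0 T hT']
  refine hfin.trans_eq ?_
  rw [mul_comm (2 * κ * β), ← div_div, div_tau_rpow_mul_eq hα0 hz0 hV0 hS hτ, hz,
    Real.div_rpow hρ0.le hk0.le]
  have p1 : 0 < ρ ^ (3 * α / 2) := by positivity
  have p2 : 0 < k ^ (3 * α / 2) := by positivity
  field_simp

end HalfLineSolution

/-- The Fokker–Planck equation in the coordinate centred at `x_*`, in expanded form. -/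
structure CenteredSolution (lam β σ α R T : ℝ) (u : ℝ → ℝ → ℝ) : Prop where
  nonneg : ∀ x, ∀ t ∈ Icc 0 T, 0 ≤ u x t
  eq_zero : ∀ x, R ≤ x → ∀ t ∈ Icc 0 T, u x t = 0
  contDiff_x : ∀ t ∈ Icc 0 T, ContDiff ℝ 2 (fun x => u x t)
  contDiffOn_t : ∀ x, ContDiffOn ℝ 1 (u x) (Icc 0 T)
  deriv_t : ∀ x, ∀ t ∈ Icc 0 T, HasDerivWithinAt (u x)
    (lam * (u x t + β * u x t ^ (α + 1) +
        x * (1 + β * (α + 1) * u x t ^ α) * deriv (fun y => u y t) x) +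
      σ ^ 2 / 2 * (2 * u x t + 4 * x * deriv (fun y => u y t) x +
        x ^ 2 * deriv (deriv fun y => u y t) x)) (Icc 0 T) t

theorem deriv_drift {w : ℝ → ℝ} {α β x₀ x : ℝ} (hα : 1 ≤ α) (hw : DifferentiableAt ℝ w x)
    (hw0 : 0 ≤ w x) : deriv (fun y => (y - x₀) * (1 + β * w y ^ α) * w y) x =
      w x + β * w x ^ (α + 1) + (x - x₀) * (1 + β * (α + 1) * w x ^ α) * deriv w x := by
  have h1 := ((((hasDerivAt_id x).sub_const x₀).mul (((hw.hasDerivAt.rpow_const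
    (Or.inr hα : w x ≠ 0 ∨ 1 ≤ α)).const_mul β).const_add 1)).mul hw.hasDerivAt).deriv
  refine h1.trans ?_
  have h2 : w x ^ α = w x ^ (α - 1) * w x := by
    rw [← Real.rpow_add_one' hw0 (by linarith), sub_add_cancel]
  have h3 : w x ^ (α + 1) = w x ^ α * w x := Real.rpow_add_one' hw0 (by linarith)
  rw [h3]
  simp only [id_eq, Pi.mul_apply]
  linear_combination (-(x - x₀) * β * α * deriv w x) * h2

theorem deriv_deriv_diffusion {w : ℝ → ℝ} {x₀ x : ℝ} (hw : ContDiff ℝ 2 w) :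
    deriv (deriv fun y => (y - x₀) ^ 2 * w y) x =
      2 * w x + 4 * (x - x₀) * deriv w x + (x - x₀) ^ 2 * deriv (deriv w) x := by
  have hw1 : ∀ y, HasDerivAt w (deriv w y) y := fun y =>
    (hw.differentiable (by simp) y).hasDerivAt
  have hw2 : HasDerivAt (deriv w) (deriv (deriv w) x) x := by
    have : ContDiff ℝ 1 (deriv w) :=
      ((contDiff_succ_iff_deriv (n := 1)).1 (by rwa [one_add_one_eq_two])).2.2
    exact (this.differentiable (by simp) x).hasDerivAt
  have hsub : ∀ y, HasDerivAt (fun y : ℝ => y - x₀) 1 y := fun y => (hasDerivAt_id y).sub_const x₀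
  have h1 : (deriv fun y => (y - x₀) ^ 2 * w y) =
      fun y => 2 * (y - x₀) * w y + (y - x₀) ^ 2 * deriv w y := by
    funext y
    refine (((hsub y).pow 2).mul (hw1 y)).deriv.trans ?_
    simp
  rw [h1]
  refine ((((hsub x).const_mul 2).mul (hw1 x)).add (((hsub x).pow 2).mul hw2)).deriv.trans ?_
  simp
  ring

theorem IsClassicalSolution.exists_centered {lam β σ α xstar T : ℝ} {f : ℝ → ℝ → ℝ} (hα : 1 ≤ α)
    (hf : IsClassicalSolution lam β σ α xstar T f) : ∃ R, 0 < R ∧ ∀ s : ℝ, |s| = 1 →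
      CenteredSolution lam β σ α R T (fun x t => f (xstar + s * x) t) := by
  obtain ⟨hnn, ⟨C, hC, hsupp⟩, hcx, hct, heq⟩ := hf
  obtain ⟨r, hr⟩ := hC.isBounded.subset_closedBall xstar
  refine ⟨|r| + 1, by positivity, fun s hs => ⟨fun x t => hnn _ t, fun x hx t ht => ?_,
    fun t ht => (hcx t ht).comp (by fun_prop), fun x => hct _, fun x t ht => ?_⟩⟩
  · by_contra hne
    have h1 := hr (hsupp t ht _ hne)
    rw [Metric.mem_closedBall, Real.dist_eq, add_sub_cancel_left, abs_mul, hs, one_mul] at h1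
    linarith [le_abs_self x, le_abs_self r]
  · have hd := hcx t ht
    have e1 : ∀ (w : ℝ → ℝ) y, deriv (fun y => w (xstar + s * y)) y =
        s * deriv w (xstar + s * y) := fun w y => by
      have := deriv_comp_mul_left s (fun z => w (xstar + z)) y
      simp only [smul_eq_mul] at this
      rw [this, deriv_comp_const_add]
    have e2 : (deriv fun y => f (xstar + s * y) t) =
        fun y => s * deriv (fun x => f x t) (xstar + s * y) := by
      funext y
      exact e1 (fun x => f x t) y
    have h := ((hct (xstar + s * x)).differentiableOn (by simp) t ht).hasDerivWithinAt
    refine h.congr_deriv ((heq _ t ht).trans ?_)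
    rw [deriv_drift hα (hd.differentiable (by simp) _) (hnn _ t ht), deriv_deriv_diffusion hd, e2,
      deriv_const_mul_field, e1]
    ring

theorem CenteredSolution.halfLine {lam β α R T : ℝ} {u : ℝ → ℝ → ℝ}
    (h : CenteredSolution lam β 0 α R T u) :
    HalfLineSolution (fun v => v + β * v ^ (α + 1)) (fun v => 1 + β * (α + 1) * v ^ α)
      lam R T u :=
  ⟨h.nonneg, h.eq_zero, fun t ht => (h.contDiff_x t ht).of_le (by norm_num), h.contDiffOn_t,
    fun x t ht => (h.deriv_t x t ht).congr_deriv (by ring)⟩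

theorem integral_eq_add_of_centered {h : ℝ → ℝ} {x₀ R : ℝ} (hh : Continuous h)
    (hp : ∀ x, R ≤ x → h (x₀ + 1 * x) = 0) (hn : ∀ x, R ≤ x → h (x₀ + -1 * x) = 0) :
    ∫ x, h x = (∫ x in 0..R, h (x₀ + 1 * x)) + ∫ x in 0..R, h (x₀ + -1 * x) := by
  set k : ℝ → ℝ := fun x => h (x₀ + x) with hk
  have hkc : Continuous k := by fun_prop
  have h1 : ∫ x, h x = ∫ x, k x := (integral_add_left_eq_self h x₀).symm
  have h2 : ∫ x, k x = ∫ x in (-R)..R, k x := by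
    refine (intervalIntegral.integral_eq_integral_of_support_subset fun x hx => ?_).symm
    by_contra hc
    rw [mem_Ioc, not_and_or, not_lt, not_le] at hc
    refine hx ?_
    rcases hc with hc | hc
    · simpa using hn (-x) (by linarith)
    · simpa using hp x hc.le
  have h3 : ∫ x in (-R)..0, k x = ∫ x in 0..R, k (-x) := by simp
  rw [h1, h2, ← intervalIntegral.integral_add_adjacent_intervals (hkc.intervalIntegrable (-R) 0)
    (hkc.intervalIntegrable 0 R), h3, add_comm]
  simp [hk]

theorem exists_ne_of_integral_pos {h : ℝ → ℝ} {x₀ : ℝ} (hh : 0 < ∫ x, h x) :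
    ∃ x, x ≠ x₀ ∧ h x ≠ 0 := by
  by_contra! hc
  refine hh.ne' (integral_eq_zero_of_ae ?_)
  filter_upwards [compl_mem_ae_iff.2 (Real.volume_singleton (a := x₀))] with x hx
  exact hc x hx

theorem second_moment_pos {h : ℝ → ℝ} {x₀ : ℝ} (hc : Continuous h) (hsupp : HasCompactSupport h)
    (h0 : ∀ x, 0 ≤ h x) (hh : 0 < ∫ x, h x) : 0 < ∫ x, (x - x₀) ^ 2 * h x := by
  obtain ⟨x, hx, hx'⟩ := exists_ne_of_integral_pos (x₀ := x₀) hh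
  exact Continuous.integral_pos_of_hasCompactSupport_nonneg_nonzero (x := x) (by fun_prop)
    hsupp.mul_left (fun y => mul_nonneg (sq_nonneg _) (h0 y))
    (mul_ne_zero (pow_ne_zero 2 (sub_ne_zero.2 hx)) hx')

theorem exists_Icc_slopeBound {u : ℝ → ℝ → ℝ} {a b c d : ℝ} (hcd : c < d)
    (ht : ∀ x ∈ Icc a b, ContinuousOn (u x) (Icc c d))
    (hpt : ∀ t ∈ Icc c d, ∃ L, SlopeBound (fun x => u x t) a b L) :
    ∃ p q, p < q ∧ Icc p q ⊆ Icc c d ∧ ∃ L, ∀ t ∈ Icc p q, SlopeBound (fun x => u x t) a b L := by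
  set π : ℝ → ℝ := fun t => projIcc c d hcd.le t with hπ
  have hπm : ∀ t, π t ∈ Icc c d := fun t => (projIcc c d hcd.le t).2
  have hπe : ∀ t ∈ Icc c d, π t = t := fun t ht => by simp [hπ, projIcc_of_mem hcd.le ht]
  have hπc : Continuous π := continuous_subtype_val.comp continuous_projIcc
  have hc : ∀ x ∈ Icc a b, Continuous fun t => u x (π t) := fun x hx =>
    (ht x hx).comp_continuous hπc hπm
  have hcl : ∀ n : ℕ, IsClosed {t | SlopeBound (fun x => u x (π t)) a b n} := fun n => by
    simp only [SlopeBound, ofPred_forall]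
    exact isClosed_iInter fun x => isClosed_iInter fun hx => isClosed_iInter fun y =>
      isClosed_iInter fun hy => isClosed_le ((hc x hx).sub (hc y hy)).abs continuous_const
  have hun : ⋃ n : ℕ, {t | SlopeBound (fun x => u x (π t)) a b n} = univ := by
    refine eq_univ_of_forall fun t => mem_iUnion.2 ?_
    obtain ⟨L, hL⟩ := hpt (π t) (hπm t)
    obtain ⟨n, hn⟩ := exists_nat_ge L
    exact ⟨n, hL.mono hn⟩
  obtain ⟨t, ht, htn⟩ := (dense_iUnion_interior_of_closed hcl hun).exists_mem_open isOpen_Ioo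
    (nonempty_Ioo.2 hcd)
  obtain ⟨n, hn⟩ := mem_iUnion.1 ht
  obtain ⟨ε, hε, hball⟩ := Metric.isOpen_iff.1 (isOpen_interior.inter isOpen_Ioo) t ⟨hn, htn⟩
  have hsub : Icc (t - ε / 2) (t + ε / 2) ⊆
      interior {t | SlopeBound (fun x => u x (π t)) a b n} ∩ Ioo c d := fun r hr => hball (by
    rw [Metric.mem_ball, Real.dist_eq, abs_lt]
    constructor <;> linarith [hr.1, hr.2])
  refine ⟨t - ε / 2, t + ε / 2, by linarith, fun r hr => Ioo_subset_Icc_self (hsub hr).2, n,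
    fun r hr => ?_⟩
  have := interior_subset (hsub hr).1
  rwa [mem_ofPred_eq, hπe r (Ioo_subset_Icc_self (hsub hr).2)] at this

theorem IsLocalMin.deriv_deriv_nonneg {φ : ℝ → ℝ} {x : ℝ} (h : IsLocalMin φ x)
    (hc : ContinuousAt φ x) : 0 ≤ deriv (deriv φ) x := by
  by_contra! hlt
  have hmax := isLocalMax_of_deriv_deriv_neg hlt h.deriv_eq_zero hc
  have heq : φ =ᶠ[𝓝 x] fun _ => φ x := by
    filter_upwards [h, hmax] with y h1 h2
    exact le_antisymm h2 h1
  have := heq.deriv.deriv_eq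
  simp at this
  linarith

theorem hasDerivAt_barrier_x (ε μ k x : ℝ) :
    HasDerivAt (fun y => ε * (Real.exp (-μ * (y - k)) - 1)) (-(ε * μ) * Real.exp (-μ * (x - k)))
      x := by
  refine (((((hasDerivAt_id x).sub_const k).const_mul (-μ)).exp.sub_const 1).const_mul
    ε).congr_deriv ?_
  simp only [id_eq]
  ring

theorem hasDerivAt_barrier_t (ε μ c k x t : ℝ) :
    HasDerivAt (fun t => ε * (Real.exp (-μ * (x - (k + c * t))) - 1))
      (ε * μ * c * Real.exp (-μ * (x - (k + c * t)))) t := by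
  refine ((((((((hasDerivAt_id t).const_mul c).const_add k).const_sub x).const_mul
    (-μ)).exp.sub_const 1).const_mul ε)).congr_deriv ?_
  simp only [id_eq]
  ring

theorem deriv_deriv_sub_barrier {v : ℝ → ℝ} (hv : ContDiff ℝ 2 v) (ε μ k x : ℝ) :
    deriv (deriv fun y => v y - ε * (Real.exp (-μ * (y - k)) - 1)) x =
      deriv (deriv v) x - ε * μ ^ 2 * Real.exp (-μ * (x - k)) := by
  have h1 : (deriv fun y => v y - ε * (Real.exp (-μ * (y - k)) - 1)) =
      fun y => deriv v y - -(ε * μ) * Real.exp (-μ * (y - k)) := by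
    funext y
    exact ((hv.differentiable (by simp) y).hasDerivAt.sub (hasDerivAt_barrier_x ε μ k y)).deriv
  have hv2 : HasDerivAt (deriv v) (deriv (deriv v) x) x := by
    have : ContDiff ℝ 1 (deriv v) :=
      ((contDiff_succ_iff_deriv (n := 1)).1 (by rwa [one_add_one_eq_two])).2.2
    exact (this.differentiable (by simp) x).hasDerivAt
  rw [h1]
  refine (hv2.sub ((((hasDerivAt_id x).sub_const k).const_mul (-μ)).exp.const_mul
    (-(ε * μ)))).deriv.trans ?_
  simp only [id_eq]
  ring

namespace CenteredSolution

variable {lam β σ α R T : ℝ} {u : ℝ → ℝ → ℝ}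

theorem eq_zero_of_slopeBound (h : CenteredSolution lam β σ α R T u) (hα : 0 < α)
    (hlam : 0 < lam) (hβ : 0 < β) (hσ : 0 < σ) {x₁ p q L : ℝ} (hx₁ : 0 < x₁) (hpq : p < q)
    (hsub : Icc p q ⊆ Icc 0 T)
    (hL : ∀ t ∈ Icc p q, SlopeBound (fun x => u x t) x₁ (R + 1) L) : u x₁ p = 0 := by
  by_contra hne
  have hp : p ∈ Icc p q := ⟨le_rfl, hpq.le⟩
  have hpos : 0 < u x₁ p := (h.nonneg x₁ p (hsub hp)).lt_of_ne' hne
  have hx₁R : x₁ < R := by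
    by_contra! hc
    exact hne (h.eq_zero x₁ hc p (hsub hp))
  obtain ⟨q', hq', hq'q, hδ⟩ : ∃ q', p < q' ∧ q' ≤ q ∧ ∀ t ∈ Icc p q', u x₁ p / 2 ≤ u x₁ t := by
    have h1 : ∀ᶠ t in 𝓝[Icc p q] p, u x₁ p / 2 < u x₁ t :=
      (((h.contDiffOn_t x₁).continuousOn.mono hsub) p hp).eventually
        (lt_mem_nhds (half_lt_self hpos))
    obtain ⟨r, hr, hr'⟩ := Metric.mem_nhdsWithin_iff.1 h1
    refine ⟨min q (p + r / 2), lt_min hpq (by linarith), min_le_left _ _, fun t ht => ?_⟩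
    have ht1 := ht.2.trans (min_le_left _ _)
    have ht2 := ht.2.trans (min_le_right _ _)
    refine le_of_lt (hr' ⟨?_, ht.1, ht1⟩)
    rw [Metric.mem_ball, Real.dist_eq, abs_lt]
    constructor <;> linarith [ht.1]
  have hsub' : Icc p q' ⊆ Icc p q := Icc_subset_Icc le_rfl hq'q
  have hucont := SlopeBound.continuousOn_prod (c := p) (d := q')
    (fun x _ => (h.contDiffOn_t x).continuousOn.mono (hsub'.trans hsub))
    (fun t ht => hL t (hsub' ht))
  have hK : IsCompact (Icc x₁ (R + 1) ×ˢ Icc p q') := isCompact_Icc.prod isCompact_Icc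
  obtain ⟨U', hU'⟩ := hK.exists_bound_of_continuousOn hucont
  obtain ⟨U, hU0, hU⟩ : ∃ U, 0 ≤ U ∧ ∀ x ∈ Icc x₁ (R + 1), ∀ t ∈ Icc p q', u x t ≤ U :=
    ⟨|U'|, abs_nonneg _, fun x hx t ht =>
      (le_abs_self _).trans ((hU' (x, t) ⟨hx, ht⟩).trans (le_abs_self U'))⟩
  obtain ⟨c, hc⟩ : ∃ c, c = (R + 1 - x₁) / (q' - p) := ⟨_, rfl⟩
  have hc0 : 0 < c := by rw [hc]; exact div_pos (by linarith) (by linarith)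
  have hcq : c * (q' - p) = R + 1 - x₁ := by
    rw [hc]; exact div_mul_cancel₀ _ (by linarith)
  obtain ⟨B, hB⟩ : ∃ B, B = (R + 1) * (lam * (1 + β * (α + 1) * U ^ α) + 2 * σ ^ 2) := ⟨_, rfl⟩
  obtain ⟨μ, hμ⟩ : ∃ μ, μ = (c + B + 1) / (σ ^ 2 / 2 * x₁ ^ 2) := ⟨_, rfl⟩
  have hB0 : 0 < B := by rw [hB]; have := hx₁.trans hx₁R; positivity
  have hμ0 : 0 < μ := by rw [hμ]; positivity
  have hμeq : σ ^ 2 / 2 * x₁ ^ 2 * μ = c + B + 1 := by rw [hμ]; field_simp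
  obtain ⟨ε, hε⟩ : ∃ ε, ε = u x₁ p / 2 * Real.exp (-μ * (R + 1 - x₁)) := ⟨_, rfl⟩
  have hε0 : 0 < ε := by rw [hε]; positivity
  obtain ⟨k, hk⟩ : ∃ k, k = x₁ - c * p := ⟨_, rfl⟩
  set w : ℝ → ℝ → ℝ := fun x t => ε * (Real.exp (-μ * (x - (k + c * t))) - 1) with hw
  have hwle : ∀ x t, k + c * t ≤ x → w x t ≤ 0 := fun x t hxt =>
    mul_nonpos_of_nonneg_of_nonpos hε0.le (by
      rw [sub_nonpos, Real.exp_le_one_iff]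
      nlinarith)
  have hwc : Continuous fun y : ℝ × ℝ => w y.1 y.2 := by
    simp only [hw]
    fun_prop
  obtain ⟨⟨x, t⟩, ⟨hx, ht⟩, hmin⟩ := hK.exists_isMinOn
    ⟨(x₁, p), ⟨le_rfl, by linarith⟩, le_rfl, hq'.le⟩ (hucont.sub hwc.continuousOn)
  have hmin' : ∀ y ∈ Icc x₁ (R + 1), ∀ r ∈ Icc p q', u x t - w x t ≤ u y r - w y r :=
    fun y hy r hr => hmin (a := (y, r)) ⟨hy, hr⟩
  have hneg : u x t - w x t < 0 := by
    have hq'm : q' ∈ Icc p q' := ⟨hq'.le, le_rfl⟩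
    refine (hmin' R ⟨hx₁R.le, by linarith⟩ q' hq'm).trans_lt ?_
    rw [h.eq_zero R le_rfl q' (hsub (hsub' hq'm)), zero_sub, neg_lt_zero]
    refine mul_pos hε0 (sub_pos.2 (Real.one_lt_exp_iff.2 ?_))
    have : R - (k + c * q') = -1 := by rw [hk]; linarith
    rw [this]
    linarith
  simp only at hx ht
  have htT := hsub (hsub' ht)
  have hu0 := h.nonneg x t htT
  have hct : c * (t - p) ≤ R + 1 - x₁ := by
    rw [← hcq]; exact mul_le_mul_of_nonneg_left (by linarith [ht.2]) hc0.le
  have hxl : x₁ < x := by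
    rcases hx.1.eq_or_lt with heq | hlt
    · exfalso
      have h1 : w x t ≤ u x₁ p / 2 := by
        have h2 : -μ * (x - (k + c * t)) ≤ μ * (R + 1 - x₁) := by
          rw [← heq, hk]
          nlinarith
        have h3 := Real.exp_le_exp.2 h2
        have h4 : ε * Real.exp (μ * (R + 1 - x₁)) = u x₁ p / 2 := by
          rw [hε, mul_assoc, ← Real.exp_add]
          simp
        have h5 := mul_le_mul_of_nonneg_left h3 hε0.le
        simp only [hw]
        linarith
      have := hδ t ht
      rw [heq] at this h1
      linarith
    · exact hlt
  have hxr : x < R + 1 := by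
    rcases hx.2.eq_or_lt with heq | hlt
    · exfalso
      have := hwle x t (by rw [heq, hk]; linarith)
      linarith
    · exact hlt
  have htl : p < t := by
    rcases ht.1.eq_or_lt with heq | hlt
    · exfalso
      have := hwle x t (by rw [← heq, hk]; linarith)
      linarith
    · exact hlt
  have hux := h.contDiff_x t htT
  set e := Real.exp (-μ * (x - (k + c * t))) with he
  have he0 : 0 < e := Real.exp_pos _
  have hloc : IsLocalMin (fun y => u y t - w y t) x := by
    filter_upwards [Icc_mem_nhds hxl hxr] with y hy
    exact hmin' y hy t ht
  have hd1 : deriv (fun y => u y t) x = -(ε * μ) * e := by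
    have := hloc.hasDerivAt_eq_zero ((hux.differentiable (by simp) x).hasDerivAt.sub
      (hasDerivAt_barrier_x ε μ (k + c * t) x))
    linarith
  have hd2 : ε * μ ^ 2 * e ≤ deriv (deriv fun y => u y t) x := by
    have hwx : Continuous fun y => w y t := by
      simp only [hw]
      fun_prop
    have := hloc.deriv_deriv_nonneg (hux.continuous.sub hwx).continuousAt
    rw [deriv_deriv_sub_barrier hux] at this
    linarith
  have hdt := (((hasDerivAt_barrier_t ε μ c k x t).hasDerivWithinAt).sub
    ((h.deriv_t x t htT).mono (hsub'.trans hsub))).nonneg_of_forall_left_le htl ht.2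
    fun r hr hrt => by
      have := hmin' x hx r ⟨hr, hrt.le.trans ht.2⟩
      simp only [hw] at this
      simp only [Pi.sub_apply]
      linarith
  rw [hd1, ← he] at hdt
  set v := u x t
  have hx0 : 0 < x := hx₁.trans hxl
  have hvU : v ^ α ≤ U ^ α := Real.rpow_le_rpow hu0 (hU x hx t ht) hα.le
  have hv1 : 0 ≤ v ^ α := Real.rpow_nonneg hu0 _
  have hv2 : 0 ≤ v ^ (α + 1) := Real.rpow_nonneg hu0 _
  have hBx : x * (lam * (1 + β * (α + 1) * v ^ α) + 2 * σ ^ 2) ≤ B := by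
    have : 0 ≤ R + 1 := hx0.le.trans hxr.le
    rw [hB]
    gcongr
  have hεe : 0 < ε * μ * e := by positivity
  have hBx' := mul_le_mul_of_nonneg_right hBx hεe.le
  have hAx : σ ^ 2 / 2 * x₁ ^ 2 * (ε * μ ^ 2 * e) ≤
      σ ^ 2 / 2 * x ^ 2 * deriv (deriv fun y => u y t) x := by
    refine mul_le_mul ?_ hd2 (by positivity) (by positivity)
    gcongr
  have hA' : σ ^ 2 / 2 * x₁ ^ 2 * (ε * μ ^ 2 * e) = (c + B + 1) * (ε * μ * e) := by
    rw [← hμeq]; ring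
  have hC : 0 ≤ lam * (v + β * v ^ (α + 1)) + σ ^ 2 * v := by positivity
  linarith

theorem initial_eq_zero (h : CenteredSolution lam β σ α R T u) (hα : 0 < α) (hlam : 0 < lam)
    (hβ : 0 < β) (hσ : 0 < σ) (hT : 0 < T) {x : ℝ} (hx : 0 < x) : u x 0 = 0 := by
  by_contra hne
  have h0 : (0 : ℝ) ∈ Icc 0 T := ⟨le_rfl, hT.le⟩
  have h1 : ∀ᶠ t in 𝓝[Icc 0 T] 0, u x t ≠ 0 :=
    ((h.contDiffOn_t x).continuousOn 0 h0).eventually_ne hne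
  obtain ⟨r, hr, hr'⟩ := Metric.mem_nhdsWithin_iff.1 h1
  have hm : 0 < min T (r / 2) := lt_min hT (by linarith)
  have hmT : Icc 0 (min T (r / 2)) ⊆ Icc 0 T := Icc_subset_Icc le_rfl (min_le_left _ _)
  obtain ⟨p, q, hpq, hsub, L, hL⟩ := exists_Icc_slopeBound (u := u) (a := x) (b := R + 1) hm
    (fun y _ => (h.contDiffOn_t y).continuousOn.mono hmT) fun t ht => by
      obtain ⟨K, hK⟩ := (h.contDiff_x t (hmT ht)).contDiffOn.exists_lipschitzOnWith
        (s := Icc x (R + 1)) (by simp) (convex_Icc _ _) isCompact_Icc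
      exact ⟨K, fun x hx y hy => hK.dist_le_mul x hx y hy⟩
  have hp := hsub ⟨le_rfl, hpq.le⟩
  refine hr' ⟨?_, hmT hp⟩ (h.eq_zero_of_slopeBound hα hlam hβ hσ hx hpq (hsub.trans hmT) hL)
  have := hp.2.trans (min_le_right _ _)
  rw [Metric.mem_ball, Real.dist_eq, abs_lt]
  constructor <;> linarith [hp.1]

end CenteredSolution

theorem IsClassicalSolution.eq_zero_of_noise {lam β σ α xstar T : ℝ} {f : ℝ → ℝ → ℝ}
    (hα : 1 ≤ α) (hlam : 0 < lam) (hβ : 0 < β) (hσ : 0 < σ) (hT : 0 < T)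
    (hf : IsClassicalSolution lam β σ α xstar T f) {x : ℝ} (hx : x ≠ xstar) : f x 0 = 0 := by
  obtain ⟨R, -, hR⟩ := hf.exists_centered hα
  rcases hx.lt_or_gt with hlt | hlt
  · simpa using (hR (-1) (by simp)).initial_eq_zero (by linarith) hlam hβ hσ hT (sub_pos.2 hlt)
  · simpa using (hR 1 (by simp)).initial_eq_zero (by linarith) hlam hβ hσ hT (sub_pos.2 hlt)

/-- **finite-time blow-up.** Let `α > 2`, `λ > 0`, `β > 0`, `σ ≥ 0` with
`σ² ≤ 2λ`. If `f` is a classical solution on `[0,T]` of the superlinear consensus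
Fokker–Planck equation with total mass `ρ = ∫ f(x,0) dx > 0` and initial second moment
`V₀ = ∫ (x - x_*)² f(x,0) dx`, then necessarily
`T < t̄ = (c_α d_α + d_α^{-2})^{3α/2} V₀^{α/2} / (2λβ ρ^{3α/2})`:
no nonnegative classical solution with positive mass exists up to time `t̄`. -/
theorem finite_time_blowup (α lam β σ xstar T : ℝ) (hα : 2 < α) (hlam : 0 < lam)
    (hβ : 0 < β) (hσ : 0 ≤ σ) (hσ2 : σ ^ 2 ≤ 2 * lam) (hT : 0 ≤ T) (f : ℝ → ℝ → ℝ)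
    (hf : IsClassicalSolution lam β σ α xstar T f)
    (ρ V₀ : ℝ) (hρ : ρ = ∫ x, f x 0) (hρpos : 0 < ρ)
    (hV₀ : V₀ = ∫ x, (x - xstar) ^ 2 * f x 0) :
    T < (cConst α * dConst α + dConst α ^ (-2 : ℝ)) ^ (3 * α / 2) * V₀ ^ (α / 2) /
      (2 * lam * β * ρ ^ (3 * α / 2)) := by
  have hα1 : 1 ≤ α := by linarith
  have h0 : (0 : ℝ) ∈ Icc 0 T := ⟨le_rfl, hT⟩
  have hcont : Continuous fun x => f x 0 := (hf.2.2.1 0 h0).continuous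
  rw [hρ] at hρpos
  have hV₀pos : 0 < V₀ := by
    obtain ⟨C, hC, hsupp⟩ := hf.2.1
    rw [hV₀]
    exact second_moment_pos hcont
      (HasCompactSupport.intro hC fun x hx => by_contra fun hne => hx (hsupp 0 h0 x hne))
      (fun x => hf.1 x 0 h0) hρpos
  rcases hT.eq_or_lt with rfl | hTpos
  · have hc := cConst_gt_two hα
    have hd := one_le_dConst hα
    rw [← hρ] at hρpos
    positivity
  rcases hσ.eq_or_lt with rfl | hσpos
  · obtain ⟨R, hR, hsol⟩ := hf.exists_centered hα1
    have hu := hsol 1 (by simp)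
    have hv := hsol (-1) (by simp)
    have hzero : ∀ s : ℝ, |s| = 1 → ∀ x, R ≤ x → f (xstar + s * x) 0 = 0 := fun s hs x hx =>
      (hsol s hs).eq_zero x hx 0 h0
    have hz1 := hzero 1 (by simp)
    have hz2 := hzero (-1) (by simp)
    refine hu.halfLine.lifespan_lt hα hβ hlam hR hTpos hv.halfLine ?_ (by rwa [hρ]) ?_ hV₀pos
    · rw [hρ]
      exact integral_eq_add_of_centered hcont hz1 hz2
    · rw [hV₀, integral_eq_add_of_centered (h := fun x => (x - xstar) ^ 2 * f x 0) (x₀ := xstar)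
        (R := R) (by fun_prop) (fun x hx => by simp only [hz1 x hx, mul_zero])
        (fun x hx => by simp only [hz2 x hx, mul_zero])]
      simp
  · obtain ⟨x, hx, hx'⟩ := exists_ne_of_integral_pos (x₀ := xstar) hρpos
    exact (hx' (hf.eq_zero_of_noise hα1 hlam hβ hσpos hTpos hx)).elim
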